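/- arXiv:1601.00151 — 8 statements merged into one kernel-verified Lean document; each statement's English description precedes it below -/
import Mathlib

section
/- Let μ be a Borel probability measure on [-1,1] and let f : ℝ → ℝ be a continuous function whose set of local extreme points is exactly {x₁ < x₂ < ⋯ < x_n}, so that f is strictly monotone on (-∞,x₁), (x₁,x₂), …, (x_n,∞). Let α > 0 satisfy x_{i+1} - x_i > 4α for all i = 1, …, n-1, and suppose there exist orientation-preserving homeomorphisms h, φ : ℝ → ℝ with φ ∘ f_α = f ∘ h. Then for each i the point y_i = h⁻¹(x_i) satisfies y_i ∈ [x_i - α, x_i + α], y_i is a local extreme point of f_α, and y_i is the unique local extreme point of f_α in the interval (x_i - 2α, x_i + 2α). -/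
open MeasureTheory Set Filter

/-- The `α`-averaging of `f` by the measure `μ` (supported on `[-1,1]`):
`f_α(x) = ∫ f(x + tα) dμ(t)`. -/
noncomputable def avg (μ : Measure ℝ) (f : ℝ → ℝ) (α : ℝ) (x : ℝ) : ℝ :=
  ∫ t, f (x + t * α) ∂μ

/-- An orientation preserving homeomorphism of `ℝ`: a strictly increasing continuous
surjection `ℝ → ℝ`. -/
def OrientHomeo (φ : ℝ → ℝ) : Prop :=
  Continuous φ ∧ StrictMono φ ∧ Function.Surjective φ

theorem measure_restrict_Icc_eq_self {μ : Measure ℝ} (hsupp : μ (Icc (-1 : ℝ) 1)ᶜ = 0) :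
    μ.restrict (Icc (-1 : ℝ) 1) = μ :=
  Measure.restrict_eq_self_of_ae_mem (mem_ae_iff.2 hsupp)

theorem integrable_avg_integrand {μ : Measure ℝ} [IsProbabilityMeasure μ]
    (hsupp : μ (Icc (-1 : ℝ) 1)ᶜ = 0) {f : ℝ → ℝ} (hf : Continuous f) (α s : ℝ) :
    Integrable (fun t ↦ f (s + t * α)) μ := by
  have hg : Continuous fun t ↦ f (s + t * α) := by fun_prop
  have := hg.continuousOn.integrableOn_compact (μ := μ) (isCompact_Icc (a := (-1 : ℝ)) (b := 1))
  rwa [IntegrableOn, measure_restrict_Icc_eq_self hsupp] at this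

theorem continuous_avg {μ : Measure ℝ} [IsProbabilityMeasure μ]
    (hsupp : μ (Icc (-1 : ℝ) 1)ᶜ = 0) {f : ℝ → ℝ} (hf : Continuous f) (α : ℝ) :
    Continuous (avg μ f α) := by
  have hg : Continuous (Function.uncurry fun s t : ℝ ↦ f (s + t * α)) := by
    unfold Function.uncurry
    fun_prop
  have := continuous_parametric_integral_of_continuous (μ := μ) hg
    (isCompact_Icc (a := (-1 : ℝ)) (b := 1))
  rwa [measure_restrict_Icc_eq_self hsupp] at this

theorem avg_le_avg {μ : Measure ℝ} [IsProbabilityMeasure μ]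
    (hsupp : μ (Icc (-1 : ℝ) 1)ᶜ = 0) {f : ℝ → ℝ} (hf : Continuous f) {α s u : ℝ}
    (hle : ∀ t ∈ Icc (-1 : ℝ) 1, f (s + t * α) ≤ f (u + t * α)) :
    avg μ f α s ≤ avg μ f α u := by
  refine integral_mono_ae (integrable_avg_integrand hsupp hf α s)
    (integrable_avg_integrand hsupp hf α u) ?_
  have hae : ∀ᵐ t ∂μ, t ∈ Icc (-1 : ℝ) 1 := mem_ae_iff.2 hsupp
  filter_upwards [hae] with t ht using hle t ht

theorem strictMonoOn_or_strictAntiOn_of_not_isLocalExtr {f : ℝ → ℝ} {a b : ℝ} (hab : a ≤ b)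
    (hf : ContinuousOn f (Icc a b)) (hno : ∀ y ∈ Ioo a b, ¬ IsLocalExtr f y) :
    StrictMonoOn f (Icc a b) ∨ StrictAntiOn f (Icc a b) := by
  have key : ∀ u ∈ Icc a b, ∀ v ∈ Icc a b, u < v → f u ≠ f v := by
    intro u hu v hv huv he
    obtain ⟨c, hc, hce⟩ := exists_isLocalExtr_Ioo huv (hf.mono (Icc_subset_Icc hu.1 hv.2)) he
    exact hno c ⟨hu.1.trans_lt hc.1, hc.2.trans_le hv.2⟩ hce
  refine hf.strictMonoOn_of_injOn_Icc' hab fun u hu v hv he ↦ ?_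
  rcases lt_trichotomy u v with hlt | heq | hlt
  · exact (key u hu v hv hlt he).elim
  · exact heq
  · exact (key v hv u hu hlt he.symm).elim

theorem IsLocalMax.monotoneOn_Icc_left {f : ℝ → ℝ} {a b : ℝ} (hab : a < b)
    (hf : ContinuousOn f (Icc a b)) (hno : ∀ y ∈ Ioo a b, ¬ IsLocalExtr f y)
    (hb : IsLocalMax f b) : MonotoneOn f (Icc a b) := by
  rcases strictMonoOn_or_strictAntiOn_of_not_isLocalExtr hab.le hf hno with hm | hm
  · exact hm.monotoneOn
  · have hev : ∀ᶠ u in nhdsWithin b (Iio b), f u ≤ f b := hb.filter_mono nhdsWithin_le_nhds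
    obtain ⟨u, hu, hu'⟩ := (hev.and (Ioo_mem_nhdsLT hab)).exists
    exact absurd (hm ⟨hu'.1.le, hu'.2.le⟩ ⟨hab.le, le_rfl⟩ hu'.2) hu.not_gt

theorem IsLocalMax.antitoneOn_Icc_right {f : ℝ → ℝ} {a b : ℝ} (hab : a < b)
    (hf : ContinuousOn f (Icc a b)) (hno : ∀ y ∈ Ioo a b, ¬ IsLocalExtr f y)
    (ha : IsLocalMax f a) : AntitoneOn f (Icc a b) := by
  rcases strictMonoOn_or_strictAntiOn_of_not_isLocalExtr hab.le hf hno with hm | hm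
  · have hev : ∀ᶠ u in nhdsWithin a (Ioi a), f u ≤ f a := ha.filter_mono nhdsWithin_le_nhds
    obtain ⟨u, hu, hu'⟩ := (hev.and (Ioo_mem_nhdsGT hab)).exists
    exact absurd (hm ⟨le_rfl, hab.le⟩ ⟨hu'.1.le, hu'.2.le⟩ hu'.1) hu.not_gt
  · exact hm.antitoneOn

theorem IsLocalMax.exists_isLocalMax_avg {μ : Measure ℝ} [IsProbabilityMeasure μ]
    (hsupp : μ (Icc (-1 : ℝ) 1)ᶜ = 0) {f : ℝ → ℝ} (hf : Continuous f) {α c : ℝ} (hα : 0 < α)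
    (hc : IsLocalMax f c)
    (hno : ∀ y ∈ Ioo (c - 3 * α) (c + 3 * α), IsLocalExtr f y → y = c) :
    ∃ w ∈ Icc (c - α) (c + α), IsLocalMax (avg μ f α) w := by
  have hleft : MonotoneOn f (Icc (c - 3 * α) c) :=
    hc.monotoneOn_Icc_left (by linarith) hf.continuousOn fun y hy he ↦
      hy.2.ne (hno y ⟨hy.1, by linarith [hy.2]⟩ he)
  have hright : AntitoneOn f (Icc c (c + 3 * α)) :=
    hc.antitoneOn_Icc_right (by linarith) hf.continuousOn fun y hy he ↦
      hy.1.ne' (hno y ⟨by linarith [hy.1], hy.2⟩ he)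
  obtain ⟨w, hw, hmax⟩ := isCompact_Icc.exists_isMaxOn (s := Icc (c - α) (c + α))
    ⟨c, by linarith, by linarith⟩ (continuous_avg hsupp hf α).continuousOn
  refine ⟨w, hw, ?_⟩
  have hnhds : Ioo (c - 2 * α) (c + 2 * α) ∈ nhds w :=
    Ioo_mem_nhds (by linarith [hw.1]) (by linarith [hw.2])
  filter_upwards [hnhds] with u hu
  obtain ⟨hu₁, hu₂⟩ := hu
  rcases lt_or_ge u (c - α) with hlt | hge
  · refine le_trans (avg_le_avg hsupp hf fun t ht ↦ ?_)
      (hmax (a := c - α) ⟨le_rfl, by linarith⟩)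
    obtain ⟨ht₁, ht₂⟩ := ht
    apply hleft
    · constructor <;> nlinarith
    · constructor <;> nlinarith
    · linarith
  rcases lt_or_ge (c + α) u with hlt | hge'
  · refine le_trans (avg_le_avg hsupp hf fun t ht ↦ ?_)
      (hmax (a := c + α) ⟨by linarith, le_rfl⟩)
    obtain ⟨ht₁, ht₂⟩ := ht
    apply hright
    · constructor <;> nlinarith
    · constructor <;> nlinarith
    · linarith
  · exact hmax ⟨hge, hge'⟩

theorem IsLocalExtr.exists_isLocalExtr_avg {μ : Measure ℝ} [IsProbabilityMeasure μ]
    (hsupp : μ (Icc (-1 : ℝ) 1)ᶜ = 0) {f : ℝ → ℝ} (hf : Continuous f) {α c : ℝ} (hα : 0 < α)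
    (hc : IsLocalExtr f c)
    (hno : ∀ y ∈ Ioo (c - 3 * α) (c + 3 * α), IsLocalExtr f y → y = c) :
    ∃ w ∈ Icc (c - α) (c + α), IsLocalExtr (avg μ f α) w := by
  rcases hc with (hmin : IsLocalMin f c) | (hmax : IsLocalMax f c)
  · have hno' : ∀ y ∈ Ioo (c - 3 * α) (c + 3 * α), IsLocalExtr (fun u ↦ -f u) y → y = c := by
      intro y hy he
      refine hno y hy ?_
      have hneg : IsLocalExtr (fun u ↦ - -f u) y := IsExtrFilter.neg he
      simpa only [neg_neg] using hneg
    obtain ⟨w, hw, hwmax⟩ :=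
      IsLocalMax.exists_isLocalMax_avg (μ := μ) hsupp hf.neg hα hmin.neg hno'
    refine ⟨w, hw, Or.inl (?_ : IsLocalMin (avg μ f α) w)⟩
    have havg : avg μ (-f) α = fun s ↦ -avg μ f α s := by
      funext s
      exact integral_neg _
    rw [havg] at hwmax
    simpa only [neg_neg] using hwmax.neg
  · obtain ⟨w, hw, hwmax⟩ := hmax.exists_isLocalMax_avg hsupp hf hα hno
    exact ⟨w, hw, Or.inr hwmax⟩

theorem OrientHomeo.isLocalExtr_of_comp {h f : ℝ → ℝ} (hh : OrientHomeo h) {z : ℝ}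
    (hz : IsLocalExtr (f ∘ h) z) : IsLocalExtr f (h z) := by
  obtain ⟨-, hmono, hsurj⟩ := hh
  let e := hmono.orderIsoOfSurjective h hsurj
  have hsymm : ∀ u, e.symm (h u) = u := fun u ↦ e.symm_apply_apply u
  have hright : ∀ u, h (e.symm u) = u := fun u ↦ e.apply_symm_apply u
  have hcont : ContinuousAt e.symm (h z) := e.symm.continuous.continuousAt
  rw [← hsymm z] at hz
  have : IsLocalExtr ((f ∘ h) ∘ e.symm) (h z) := IsExtrFilter.comp_tendsto hz hcont
  simpa only [Function.comp_def, hright] using this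

theorem four_mul_lt_sub_of_lt {n : ℕ} {x : Fin n → ℝ} (hx : StrictMono x) {α : ℝ}
    (hspace : ∀ i j : Fin n, (j : ℕ) = (i : ℕ) + 1 → 4 * α < x j - x i)
    {i j : Fin n} (hij : i < j) : 4 * α < x j - x i := by
  have hk : (i : ℕ) + 1 < n := lt_of_le_of_lt (Nat.succ_le_of_lt hij) j.2
  have := hspace i ⟨i + 1, hk⟩ rfl
  have hle : x ⟨i + 1, hk⟩ ≤ x j := hx.monotone (Nat.succ_le_of_lt hij)
  linarith

theorem localized_extrema_of_averaging
    (μ : Measure ℝ) [IsProbabilityMeasure μ] (hsupp : μ (Icc (-1 : ℝ) 1)ᶜ = 0)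
    (f : ℝ → ℝ) (hf : Continuous f)
    (n : ℕ) (x : Fin n → ℝ) (hx : StrictMono x)
    (hext : {y : ℝ | IsLocalExtr f y} = Set.range x)
    (α : ℝ) (hα : 0 < α)
    (hspace : ∀ i j : Fin n, (j : ℕ) = (i : ℕ) + 1 → 4 * α < x j - x i)
    (h φ : ℝ → ℝ) (hh : OrientHomeo h) (hφ : OrientHomeo φ)
    (heq : ∀ y, φ (avg μ f α y) = f (h y)) :
    ∀ i : Fin n, ∀ y : ℝ, h y = x i →
      y ∈ Icc (x i - α) (x i + α) ∧
      IsLocalExtr (avg μ f α) y ∧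
      ∀ z ∈ Ioo (x i - 2 * α) (x i + 2 * α), IsLocalExtr (avg μ f α) z → z = y := by
  have hsep : ∀ i j : Fin n, x j - x i < 4 * α → x i - x j < 4 * α → i = j := by
    intro i j h₁ h₂
    rcases lt_trichotomy i j with hlt | he | hlt
    · exact absurd (four_mul_lt_sub_of_lt hx hspace hlt) h₁.not_gt
    · exact he
    · exact absurd (four_mul_lt_sub_of_lt hx hspace hlt) h₂.not_gt
  have hrange : ∀ y, IsLocalExtr f y ↔ ∃ j, x j = y := fun y ↦ Set.ext_iff.1 hext y
  have hcrit : ∀ z, IsLocalExtr (avg μ f α) z → ∃ j, x j = h z := by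
    intro z hz
    rw [← hrange]
    apply hh.isLocalExtr_of_comp
    have := IsExtrFilter.comp_mono hz hφ.2.1.monotone
    rwa [show φ ∘ avg μ f α = f ∘ h from funext heq] at this
  have hexists : ∀ i, ∃ w ∈ Icc (x i - α) (x i + α), IsLocalExtr (avg μ f α) w := by
    intro i
    refine ((hrange _).2 ⟨i, rfl⟩).exists_isLocalExtr_avg hsupp hf hα fun y hy he ↦ ?_
    obtain ⟨j, rfl⟩ := (hrange y).1 he
    rw [hsep i j (by linarith [hy.2]) (by linarith [hy.1])]
  choose w hw hwext using hexists
  choose σ hσ using fun i ↦ hcrit (w i) (hwext i)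
  have hσmono : StrictMono σ := by
    intro i j hij
    rw [← hx.lt_iff_lt, hσ, hσ]
    apply hh.2.1
    linarith [(hw i).2, (hw j).1, four_mul_lt_sub_of_lt hx hspace hij]
  have hσid : ∀ i, σ i = i := fun i ↦ le_antisymm (hσmono.le_id i) (hσmono.id_le i)
  have hw_eq : ∀ i y, h y = x i → y = w i := by
    intro i y hy
    apply hh.2.1.injective
    rw [hy, ← hσ, hσid]
  intro i y hy
  obtain rfl := hw_eq i y hy
  refine ⟨hw i, hwext i, fun z hz hzext ↦ ?_⟩
  obtain ⟨j, hj⟩ := hcrit z hzext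
  obtain rfl := hw_eq j z hj.symm
  rw [hsep i j (by linarith [hz.2, (hw j).1]) (by linarith [hz.1, (hw j).2])]
end

section
/- Let f : [a,b] → ℝ be continuous and piecewise 2-differentiable with break set S ⊂ (a,b). Suppose f″(x) > 0 for all x ∈ [a,b] ∖ S and lim_{t→s⁻} f′(t) ≤ lim_{t→s⁺} f′(t) for every s ∈ S. Then f is strictly convex on [a,b]. -/
open Set Filter

/-- One direction of the mean value theorem for a function that may fail to be differentiable at
finitely many points. -/
theorem exists_deriv_mul_le_sub_off_finset (f f' : ℝ → ℝ) (S : Finset ℝ) :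
    ∀ u v : ℝ, u < v → ContinuousOn f (Icc u v) →
      (∀ t ∈ Ioo u v \ ↑S, HasDerivAt f (f' t) t) →
      ∃ t ∈ Ioo u v \ ↑S, f' t * (v - u) ≤ f v - f u := by
  induction S using Finset.induction_on with
  | empty =>
    intro u v huv hf hd
    obtain ⟨t, ht, h⟩ := exists_hasDerivAt_eq_slope f f' huv hf
      (fun t ht => hd t (by simpa using ht))
    refine ⟨t, by simpa using ht, ?_⟩
    rw [h, div_mul_cancel₀ _ (sub_pos.2 huv).ne']
  | insert s S _ ih =>
    intro u v huv hf hd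
    by_cases hs : s ∈ Ioo u v
    · obtain ⟨hus, hsv⟩ := hs
      obtain ⟨t₁, ⟨ht₁, ht₁S⟩, h₁⟩ := ih u s hus (hf.mono (Icc_subset_Icc_right hsv.le))
        (fun t ht => hd t ⟨⟨ht.1.1, ht.1.2.trans hsv⟩, by
          have := ht.2
          have := ht.1.2.ne
          simp_all⟩)
      obtain ⟨t₂, ⟨ht₂, ht₂S⟩, h₂⟩ := ih s v hsv (hf.mono (Icc_subset_Icc_left hus.le))
        (fun t ht => hd t ⟨⟨hus.trans ht.1.1, ht.1.2⟩, by
          have := ht.2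
          have := ht.1.1.ne'
          simp_all⟩)
      rcases le_total (f' t₁) (f' t₂) with h | h
      · refine ⟨t₁, ⟨⟨ht₁.1, ht₁.2.trans hsv⟩, ?_⟩, ?_⟩
        · have := ht₁.2.ne
          simp_all
        · nlinarith
      · refine ⟨t₂, ⟨⟨hus.trans ht₂.1, ht₂.2⟩, ?_⟩, ?_⟩
        · have := ht₂.1.ne'
          simp_all
        · nlinarith
    · have hE : Ioo u v \ ↑(insert s S) = Ioo u v \ (S : Set ℝ) := by
        rw [Finset.coe_insert, ← union_singleton, union_comm, ← sdiff_sdiff,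
          sdiff_singleton_eq_self hs]
      rw [hE] at hd ⊢
      exact ih u v huv hf hd

theorem StrictMonoOn.lt_of_tendsto_nhdsLT {g : ℝ → ℝ} {A : Set ℝ} {s l x : ℝ}
    (hg : StrictMonoOn g A) (hA : ∀ᶠ t in nhdsWithin s (Iio s), t ∈ A)
    (hl : Tendsto g (nhdsWithin s (Iio s)) (nhds l)) (hx : x ∈ A) (hxs : x < s) : g x < l := by
  obtain ⟨y, hyA, hxy, hys⟩ := (hA.and (Ioo_mem_nhdsLT hxs)).exists
  refine (hg hx hyA hxy).trans_le (ge_of_tendsto hl ?_)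
  filter_upwards [hA, Ioo_mem_nhdsLT hys] with t htA ht
  exact (hg hyA htA ht.1).le

theorem StrictMonoOn.gt_of_tendsto_nhdsGT {g : ℝ → ℝ} {A : Set ℝ} {s r x : ℝ}
    (hg : StrictMonoOn g A) (hA : ∀ᶠ t in nhdsWithin s (Ioi s), t ∈ A)
    (hr : Tendsto g (nhdsWithin s (Ioi s)) (nhds r)) (hx : x ∈ A) (hsx : s < x) : r < g x := by
  obtain ⟨y, hyA, hsy, hyx⟩ := (hA.and (Ioo_mem_nhdsGT hsx)).exists
  refine (le_of_tendsto hr ?_).trans_lt (hg hyA hx hyx)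
  filter_upwards [hA, Ioo_mem_nhdsGT hsy] with t htA ht
  exact (hg htA hyA ht.2).le

/-- A function with positive derivative off a finite set, at whose points it only jumps upwards,
is strictly increasing off that set. -/
theorem strictMonoOn_Ioo_diff_finset_of_deriv_pos (g g' : ℝ → ℝ) (S : Finset ℝ)
    (hlim : ∀ s ∈ S, ∃ l r : ℝ,
      Tendsto g (nhdsWithin s (Iio s)) (nhds l) ∧
      Tendsto g (nhdsWithin s (Ioi s)) (nhds r) ∧ l ≤ r) :
    ∀ u v : ℝ, (∀ t ∈ Ioo u v \ ↑S, HasDerivAt g (g' t) t) →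
      (∀ t ∈ Ioo u v \ ↑S, 0 < g' t) → StrictMonoOn g (Ioo u v \ ↑S) := by
  induction S using Finset.induction_on with
  | empty =>
    intro u v hd hpos
    simp only [Finset.coe_empty, sdiff_empty] at *
    refine strictMonoOn_of_deriv_pos (convex_Ioo u v)
      (fun t ht => (hd t ht).continuousAt.continuousWithinAt) fun t ht => ?_
    rw [interior_Ioo] at ht
    rw [(hd t ht).deriv]
    exact hpos t ht
  | insert s S hsS ih =>
    intro u v hd hpos
    replace ih := ih fun s hs => hlim s (Finset.mem_insert_of_mem hs)
    by_cases hs : s ∈ Ioo u v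
    · obtain ⟨hus, hsv⟩ := hs
      have hL : Ioo u s \ (S : Set ℝ) ⊆ Ioo u v \ ↑(insert s S) := fun t ht =>
        ⟨⟨ht.1.1, ht.1.2.trans hsv⟩, by
          have := ht.2
          have := ht.1.2.ne
          simp_all⟩
      have hR : Ioo s v \ (S : Set ℝ) ⊆ Ioo u v \ ↑(insert s S) := fun t ht =>
        ⟨⟨hus.trans ht.1.1, ht.1.2⟩, by
          have := ht.2
          have := ht.1.1.ne'
          simp_all⟩
      have hmL := ih u s (fun t ht => hd t (hL ht)) fun t ht => hpos t (hL ht)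
      have hmR := ih s v (fun t ht => hd t (hR ht)) fun t ht => hpos t (hR ht)
      have hS : (S : Set ℝ)ᶜ ∈ nhds s :=
        S.finite_toSet.isClosed.isOpen_compl.mem_nhds (by simpa using hsS)
      obtain ⟨l, r, hl, hr, hlr⟩ := hlim s (Finset.mem_insert_self s S)
      intro x hx y hy hxy
      have hxS : x ∉ (S : Set ℝ) := fun h => hx.2 (by simp_all)
      have hyS : y ∉ (S : Set ℝ) := fun h => hy.2 (by simp_all)
      have hxs : x ≠ s := fun h => hx.2 (by simp [h])
      have hys : y ≠ s := fun h => hy.2 (by simp [h])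
      rcases hxs.lt_or_gt with hxs | hxs
      · have hx' : x ∈ Ioo u s \ (S : Set ℝ) := ⟨⟨hx.1.1, hxs⟩, hxS⟩
        rcases hys.lt_or_gt with hys | hys
        · exact hmL hx' ⟨⟨hy.1.1, hys⟩, hyS⟩ hxy
        · have h₁ := hmL.lt_of_tendsto_nhdsLT
            (inter_mem (Ioo_mem_nhdsLT hus) (mem_nhdsWithin_of_mem_nhds hS)) hl hx' hxs
          have h₂ := hmR.gt_of_tendsto_nhdsGT
            (inter_mem (Ioo_mem_nhdsGT hsv) (mem_nhdsWithin_of_mem_nhds hS)) hr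
            ⟨⟨hys, hy.1.2⟩, hyS⟩ hys
          exact h₁.trans_le (hlr.trans h₂.le)
      · exact hmR ⟨⟨hxs, hx.1.2⟩, hxS⟩ ⟨⟨hxs.trans hxy, hy.1.2⟩, hyS⟩ hxy
    · have hE : Ioo u v \ ↑(insert s S) = Ioo u v \ (S : Set ℝ) := by
        rw [Finset.coe_insert, ← union_singleton, union_comm, ← sdiff_sdiff,
          sdiff_singleton_eq_self hs]
      rw [hE] at hd hpos ⊢
      exact ih u v hd hpos

theorem strictConvexOn_of_piecewise_pos_second_deriv
    (a b : ℝ) (f f' f'' : ℝ → ℝ) (S : Finset ℝ) (hS : ↑S ⊆ Ioo a b)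
    (hf : ContinuousOn f (Icc a b))
    (hderiv1 : ∀ x ∈ Icc a b \ ↑S, HasDerivWithinAt f (f' x) (Icc a b) x)
    (hderiv2 : ∀ x ∈ Icc a b \ ↑S, HasDerivWithinAt f' (f'' x) (Icc a b \ ↑S) x)
    (hf'cont : ContinuousOn f' (Icc a b \ ↑S))
    (hf''cont : ContinuousOn f'' (Icc a b \ ↑S))
    (hlim1 : ∀ s ∈ S, ∃ l r : ℝ,
      Tendsto f' (nhdsWithin s (Iio s)) (nhds l) ∧
      Tendsto f' (nhdsWithin s (Ioi s)) (nhds r) ∧ l ≤ r)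
    (hlim2 : ∀ s ∈ S,
      (∃ l : ℝ, Tendsto f'' (nhdsWithin s (Iio s)) (nhds l)) ∧
      (∃ r : ℝ, Tendsto f'' (nhdsWithin s (Ioi s)) (nhds r)))
    (hpos : ∀ x ∈ Icc a b \ ↑S, 0 < f'' x) :
    StrictConvexOn ℝ (Icc a b) f := by
  have hsub : Ioo a b \ (S : Set ℝ) ⊆ Icc a b \ ↑S := sdiff_subset_sdiff_left Ioo_subset_Icc_self
  have hnhds : ∀ t ∈ Ioo a b \ (S : Set ℝ), Icc a b \ (S : Set ℝ) ∈ nhds t := fun t ht =>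
    mem_of_superset ((isOpen_Ioo.sdiff S.finite_toSet.isClosed).mem_nhds ht) hsub
  have hd1 : ∀ t ∈ Ioo a b \ (S : Set ℝ), HasDerivAt f (f' t) t := fun t ht =>
    (hderiv1 t (hsub ht)).hasDerivAt (mem_of_superset (hnhds t ht) sdiff_subset)
  have hmono : StrictMonoOn f' (Ioo a b \ ↑S) :=
    strictMonoOn_Ioo_diff_finset_of_deriv_pos f' f'' S hlim1 a b
      (fun t ht => (hderiv2 t (hsub ht)).hasDerivAt (hnhds t ht)) fun t ht => hpos t (hsub ht)
  refine strictConvexOn_of_slope_strict_mono_adjacent (convex_Icc a b) ?_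
  intro x y z hx hz hxy hyz
  have hL : Ioo x y \ (S : Set ℝ) ⊆ Ioo a b \ ↑S :=
    sdiff_subset_sdiff_left (Ioo_subset_Ioo hx.1 (hyz.le.trans hz.2))
  have hR : Ioo y z \ (S : Set ℝ) ⊆ Ioo a b \ ↑S :=
    sdiff_subset_sdiff_left (Ioo_subset_Ioo (hx.1.trans hxy.le) hz.2)
  obtain ⟨t₁, ht₁, h₁⟩ := exists_deriv_mul_le_sub_off_finset (-f) (-f') S x y hxy
    (hf.mono (Icc_subset_Icc hx.1 (hyz.le.trans hz.2))).neg fun t ht => (hd1 t (hL ht)).neg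
  obtain ⟨t₂, ht₂, h₂⟩ := exists_deriv_mul_le_sub_off_finset f f' S y z hyz
    (hf.mono (Icc_subset_Icc (hx.1.trans hxy.le) hz.2)) fun t ht => hd1 t (hR ht)
  simp only [Pi.neg_apply] at h₁
  calc (f y - f x) / (y - x) ≤ f' t₁ := by
        rw [div_le_iff₀ (sub_pos.2 hxy)]
        linarith
    _ < f' t₂ := hmono (hL ht₁) (hR ht₂) (ht₁.1.2.trans ht₂.1.1)
    _ ≤ (f z - f y) / (z - y) := by
        rwa [le_div_iff₀ (sub_pos.2 hyz)]
end

section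
/- Let f : [a,b] → ℝ be continuous, let S ⊂ (a,b) be a finite set such that f is continuously differentiable on [a,b] ∖ S with finite one-sided limits of f′ at each point of S, and suppose f′(x) < f′(y) for all x < y in [a,b] ∖ S. Then for all x < y in [a,b] the one-sided limits f′_r(x) = lim_{t→x⁺} f′(t) and f′_l(y) = lim_{t→y⁻} f′(t) exist and satisfy f(x) + (y-x)·f′_r(x) < f(y) < f(x) + (y-x)·f′_l(y). -/
open Set Filter

/-- A continuous function whose derivative is positive off a finite set is larger at the right
endpoint of an interval than at the left one. -/
theorem lt_of_hasDerivAt_pos_off_finset (S : Finset ℝ) (g g' : ℝ → ℝ) {x y : ℝ} (hxy : x < y)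
    (hg : ContinuousOn g (Icc x y))
    (hd : ∀ t ∈ Ioo x y \ ↑S, HasDerivAt g (g' t) t)
    (hpos : ∀ t ∈ Ioo x y \ ↑S, 0 < g' t) : g x < g y := by
  induction S using Finset.induction_on generalizing x y with
  | empty =>
    have hmono : StrictMonoOn g (Icc x y) := by
      refine strictMonoOn_of_deriv_pos (convex_Icc x y) hg fun t ht ↦ ?_
      rw [interior_Icc] at ht
      rw [(hd t ⟨ht, by simp⟩).deriv]
      exact hpos t ⟨ht, by simp⟩
    exact hmono (left_mem_Icc.2 hxy.le) (right_mem_Icc.2 hxy.le) hxy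
  | insert s S _ ih =>
    by_cases hs : s ∈ Ioo x y
    · have hl : ∀ t ∈ Ioo x s \ ↑S, t ∈ Ioo x y \ ↑(insert s S) := fun t ht ↦
        ⟨⟨ht.1.1, ht.1.2.trans hs.2⟩, by simpa using ⟨ht.1.2.ne, ht.2⟩⟩
      have hr : ∀ t ∈ Ioo s y \ ↑S, t ∈ Ioo x y \ ↑(insert s S) := fun t ht ↦
        ⟨⟨hs.1.trans ht.1.1, ht.1.2⟩, by simpa using ⟨ht.1.1.ne', ht.2⟩⟩
      exact (ih hs.1 (hg.mono (Icc_subset_Icc_right hs.2.le)) (fun t ht ↦ hd t (hl t ht))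
        fun t ht ↦ hpos t (hl t ht)).trans
        (ih hs.2 (hg.mono (Icc_subset_Icc_left hs.1.le)) (fun t ht ↦ hd t (hr t ht))
        fun t ht ↦ hpos t (hr t ht))
    · have h : ∀ t ∈ Ioo x y \ ↑S, t ∈ Ioo x y \ ↑(insert s S) := fun t ht ↦
        ⟨ht.1, by simpa using ⟨fun e : t = s ↦ hs (e ▸ ht.1), ht.2⟩⟩
      exact ih hxy hg (fun t ht ↦ hd t (h t ht)) fun t ht ↦ hpos t (h t ht)

/-- Near any point, a finite set contains at most that point. -/
theorem eventually_notMem_finset_nhdsNE (S : Finset ℝ) (x : ℝ) :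
    ∀ᶠ u in nhdsWithin x {x}ᶜ, u ∉ S := by
  have h : ((S.erase x : Finset ℝ) : Set ℝ)ᶜ ∈ nhds x :=
    (S.erase x).finite_toSet.isClosed.isOpen_compl.mem_nhds (by simp)
  filter_upwards [mem_nhdsWithin_of_mem_nhds h, self_mem_nhdsWithin] with u hu hux hS
  exact hu (Finset.mem_coe.2 (Finset.mem_erase.2 ⟨hux, hS⟩))

theorem secant_estimates_of_piecewise_strictMono_deriv
    (a b : ℝ) (f f' : ℝ → ℝ) (S : Finset ℝ) (hS : ↑S ⊆ Ioo a b)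
    (hf : ContinuousOn f (Icc a b))
    (hderiv : ∀ x ∈ Icc a b \ ↑S, HasDerivWithinAt f (f' x) (Icc a b) x)
    (hf' : ContinuousOn f' (Icc a b \ ↑S))
    (hlim : ∀ s ∈ S,
      (∃ l : ℝ, Tendsto f' (nhdsWithin s (Iio s)) (nhds l)) ∧
      (∃ r : ℝ, Tendsto f' (nhdsWithin s (Ioi s)) (nhds r)))
    (hmono : ∀ x ∈ Icc a b \ ↑S, ∀ y ∈ Icc a b \ ↑S, x < y → f' x < f' y) :
    ∀ x ∈ Icc a b, ∀ y ∈ Icc a b, x < y →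
      ∃ rx ly : ℝ,
        Tendsto f' (nhdsWithin x (Ioi x)) (nhds rx) ∧
        Tendsto f' (nhdsWithin y (Iio y)) (nhds ly) ∧
        f x + (y - x) * rx < f y ∧ f y < f x + (y - x) * ly := by
  intro x hx y hy hxy
  have hright : ∀ᶠ u in nhdsWithin x (Ioi x), u ∉ S :=
    (eventually_notMem_finset_nhdsNE S x).filter_mono
      (nhdsWithin_mono x fun u hu ↦ ne_of_gt hu)
  have hleft : ∀ᶠ u in nhdsWithin y (Iio y), u ∉ S :=
    (eventually_notMem_finset_nhdsNE S y).filter_mono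
      (nhdsWithin_mono y fun u hu ↦ ne_of_lt hu)
  have hsub : ∀ t ∈ Ioo x y, t ∈ Icc a b := fun t ht ↦
    ⟨hx.1.trans ht.1.le, ht.2.le.trans hy.2⟩
  obtain ⟨rx, hrx⟩ : ∃ r : ℝ, Tendsto f' (nhdsWithin x (Ioi x)) (nhds r) := by
    by_cases hxS : x ∈ S
    · exact (hlim x hxS).2
    · refine ⟨f' x, (hf' x ⟨hx, hxS⟩).mono_left (nhdsWithin_le_iff.2 ?_)⟩
      filter_upwards [hright, Ioo_mem_nhdsGT hxy] with u hu hu'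
      exact ⟨hsub u hu', hu⟩
  obtain ⟨ly, hly⟩ : ∃ l : ℝ, Tendsto f' (nhdsWithin y (Iio y)) (nhds l) := by
    by_cases hyS : y ∈ S
    · exact (hlim y hyS).1
    · refine ⟨f' y, (hf' y ⟨hy, hyS⟩).mono_left (nhdsWithin_le_iff.2 ?_)⟩
      filter_upwards [hleft, Ioo_mem_nhdsLT hxy] with u hu hu'
      exact ⟨hsub u hu', hu⟩
  have hrx_lt : ∀ t ∈ Ioo x y \ ↑S, rx < f' t := by
    intro t ht
    obtain ⟨v, hv, hvS⟩ := (Ioo_infinite ht.1.1).exists_notMem_finset S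
    have hvI : v ∈ Icc a b \ ↑S := ⟨hsub v ⟨hv.1, hv.2.trans ht.1.2⟩, hvS⟩
    refine lt_of_le_of_lt (le_of_tendsto hrx ?_) (hmono v hvI t ⟨hsub t ht.1, ht.2⟩ hv.2)
    filter_upwards [hright, Ioo_mem_nhdsGT hv.1] with u hu hu'
    exact (hmono u ⟨hsub u ⟨hu'.1, hu'.2.trans (hv.2.trans ht.1.2)⟩, hu⟩ v hvI hu'.2).le
  have hlt_ly : ∀ t ∈ Ioo x y \ ↑S, f' t < ly := by
    intro t ht
    obtain ⟨v, hv, hvS⟩ := (Ioo_infinite ht.1.2).exists_notMem_finset S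
    have hvI : v ∈ Icc a b \ ↑S := ⟨hsub v ⟨ht.1.1.trans hv.1, hv.2⟩, hvS⟩
    refine lt_of_lt_of_le (hmono t ⟨hsub t ht.1, ht.2⟩ v hvI hv.1) (ge_of_tendsto hly ?_)
    filter_upwards [hleft, Ioo_mem_nhdsLT hv.2] with u hu hu'
    exact (hmono v hvI u ⟨hsub u ⟨(ht.1.1.trans hv.1).trans hu'.1, hu'.2⟩, hu⟩ hu'.1).le
  have hfxy : ContinuousOn f (Icc x y) := hf.mono (Icc_subset_Icc hx.1 hy.2)
  have hd : ∀ t ∈ Ioo x y \ ↑S, HasDerivAt f (f' t) t := fun t ht ↦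
    (hderiv t ⟨hsub t ht.1, ht.2⟩).hasDerivAt
      (Icc_mem_nhds (hx.1.trans_lt ht.1.1) (ht.1.2.trans_le hy.2))
  have hlin (c t : ℝ) : HasDerivAt (fun t ↦ c * t) c t := by
    simpa using (hasDerivAt_id t).const_mul c
  refine ⟨rx, ly, hrx, hly, ?_, ?_⟩
  · have h := lt_of_hasDerivAt_pos_off_finset S (fun t ↦ f t - rx * t) (fun t ↦ f' t - rx) hxy
      (hfxy.sub (by fun_prop)) (fun t ht ↦ (hd t ht).sub (hlin rx t))
      fun t ht ↦ sub_pos.2 (hrx_lt t ht)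
    linarith
  · have h := lt_of_hasDerivAt_pos_off_finset S (fun t ↦ ly * t - f t) (fun t ↦ ly - f' t) hxy
      (ContinuousOn.sub (by fun_prop) hfxy) (fun t ht ↦ (hlin ly t).sub (hd t ht))
      fun t ht ↦ sub_pos.2 (hlt_ly t ht)
    linarith
end

section
/- Fix -1 = t₀ < t₁ < ⋯ < t_n < t_{n+1} = 1 and nonnegative reals p₀, …, p_n with Σ_{i=0}^{n} (t_{i+1}-t_i) p_i = 1, and let μ be the Borel probability measure on [-1,1] with piecewise constant density equal to p_i on [t_i, t_{i+1}). Let k ≥ 1 and let f : [a,b] → ℝ be of class C^k, and let 0 < 2α < b - a. Then the α-averaging f_α is of class C^{k+1} on (a+α, b-α). -/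
open MeasureTheory Set Filter

/-- The measure on `ℝ` with piecewise constant density taking the value `p i`
on `[t i, t (i+1))`. -/
noncomputable def stepMeasure (n : ℕ) (t : Fin (n + 2) → ℝ) (p : Fin (n + 1) → ℝ) :
    Measure ℝ :=
  volume.withDensity fun x =>
    ENNReal.ofReal
      (∑ i : Fin (n + 1), Set.indicator (Ico (t i.castSucc) (t i.succ)) (fun _ => p i) x)

theorem ContDiffOn.intervalIntegral_succ {f : ℝ → ℝ} {a b c : ℝ} {k : ℕ}
    (hf : ContDiffOn ℝ k f (Ioo a b)) (hc : c ∈ Ioo a b) :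
    ContDiffOn ℝ (k + 1) (fun y => ∫ s in c..y, f s) (Ioo a b) := by
  have key : ∀ y ∈ Ioo a b, HasDerivAt (fun y => ∫ s in c..y, f s) (f y) y := by
    intro y hy
    refine intervalIntegral.integral_hasDerivAt_right ?_ ?_ ?_
    · exact (hf.continuousOn.mono (ordConnected_Ioo.uIcc_subset hc hy)).intervalIntegrable
    · exact hf.continuousOn.stronglyMeasurableAtFilter isOpen_Ioo y hy
    · exact hf.continuousOn.continuousAt (isOpen_Ioo.mem_nhds hy)
  rw [contDiffOn_succ_iff_deriv_of_isOpen isOpen_Ioo]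
  refine ⟨fun y hy => (key y hy).differentiableAt.differentiableWithinAt, by simp, ?_⟩
  exact hf.congr fun y hy => (key y hy).deriv

/-- Integration against a step measure is a weighted sum of interval integrals. -/
theorem integral_stepMeasure (n : ℕ) (t : Fin (n + 2) → ℝ) (p : Fin (n + 1) → ℝ)
    (ht : Monotone t) (hp : ∀ i, 0 ≤ p i) (g : ℝ → ℝ)
    (hg : ∀ i : Fin (n + 1), IntervalIntegrable g volume (t i.castSucc) (t i.succ)) :
    ∫ s, g s ∂(stepMeasure n t p) =
      ∑ i : Fin (n + 1), p i * ∫ s in t i.castSucc..t i.succ, g s := by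
  have hle : ∀ i : Fin (n + 1), t i.castSucc ≤ t i.succ := fun i => ht i.castSucc_le_succ
  have hnn : ∀ x, 0 ≤ ∑ i : Fin (n + 1),
      indicator (Ico (t i.castSucc) (t i.succ)) (fun _ => p i) x := fun x =>
    Finset.sum_nonneg fun i _ => indicator_nonneg (fun _ _ => hp i) x
  have hint : ∀ i : Fin (n + 1), Integrable
      (indicator (Ico (t i.castSucc) (t i.succ)) fun s => p i * g s) := by
    intro i
    rw [integrable_indicator_iff measurableSet_Ico]
    exact ((intervalIntegrable_iff_integrableOn_Ico_of_le (hle i)).1 (hg i)).const_mul (p i)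
  have hmeas : Measurable fun x => ENNReal.ofReal (∑ i : Fin (n + 1),
      indicator (Ico (t i.castSucc) (t i.succ)) (fun _ => p i) x) :=
    (Finset.measurable_fun_sum _ fun i _ =>
      measurable_const.indicator measurableSet_Ico).ennreal_ofReal
  rw [stepMeasure, integral_withDensity_eq_integral_toReal_smul hmeas (by simp)]
  calc
    _ = ∫ s, ∑ i : Fin (n + 1),
        indicator (Ico (t i.castSucc) (t i.succ)) (fun s => p i * g s) s := by
      congr 1 with s
      rw [ENNReal.toReal_ofReal (hnn s), smul_eq_mul, Finset.sum_mul]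
      exact Finset.sum_congr rfl fun i _ => (indicator_mul_left _ _ _).symm
    _ = _ := by
      rw [integral_finsetSum _ fun i _ => hint i]
      refine Finset.sum_congr rfl fun i _ => ?_
      rw [integral_indicator measurableSet_Ico, integral_const_mul,
        intervalIntegral.integral_of_le (hle i), integral_Ico_eq_integral_Ioc]

theorem averaging_contDiff_succ_stepMeasure
    (n : ℕ) (t : Fin (n + 2) → ℝ) (p : Fin (n + 1) → ℝ)
    (ht : StrictMono t) (ht0 : t 0 = -1) (htlast : t (Fin.last (n + 1)) = 1)
    (hp : ∀ i, 0 ≤ p i)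
    (hsum : ∑ i : Fin (n + 1), (t i.succ - t i.castSucc) * p i = 1)
    (a b α : ℝ) (k : ℕ) (hk : 1 ≤ k)
    (f : ℝ → ℝ) (hf : ContDiffOn ℝ k f (Icc a b))
    (hα : 0 < α) (h2α : 2 * α < b - a) :
    ContDiffOn ℝ (k + 1) (avg (stepMeasure n t p) f α) (Ioo (a + α) (b - α)) := by
  obtain ⟨c, hc⟩ : (Ioo a b).Nonempty := nonempty_Ioo.2 (by linarith)
  have hf' : ContDiffOn ℝ k f (Ioo a b) := hf.mono Ioo_subset_Icc_self
  have hbound : ∀ j, t j ∈ Icc (-1 : ℝ) 1 := fun j =>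
    ⟨ht0 ▸ ht.monotone (Fin.zero_le j), htlast ▸ ht.monotone (Fin.le_last j)⟩
  have hmaps : ∀ x ∈ Ioo (a + α) (b - α), ∀ s ∈ Icc (-1 : ℝ) 1, x + s * α ∈ Ioo a b := by
    rintro x ⟨hx₁, hx₂⟩ s ⟨hs₁, hs₂⟩
    constructor <;> nlinarith
  have hF := hf'.intervalIntegral_succ hc
  have hshift : ∀ j, ContDiffOn ℝ (k + 1) (fun x => ∫ s in c..(x + t j * α), f s)
      (Ioo (a + α) (b - α)) := fun j =>
    hF.comp (contDiff_id.add contDiff_const).contDiffOn fun x hx => hmaps x hx _ (hbound j)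
  have hII : ∀ y ∈ Ioo a b, IntervalIntegrable f volume c y := fun y hy =>
    (hf'.continuousOn.mono (ordConnected_Ioo.uIcc_subset hc hy)).intervalIntegrable
  have hsmooth : ContDiffOn ℝ (k + 1) (fun x => ∑ i : Fin (n + 1), p i * (α⁻¹ *
      ((∫ s in c..(x + t i.succ * α), f s) - ∫ s in c..(x + t i.castSucc * α), f s)))
      (Ioo (a + α) (b - α)) :=
    ContDiffOn.sum fun i _ => contDiffOn_const.mul
      (contDiffOn_const.mul ((hshift i.succ).sub (hshift i.castSucc)))
  refine hsmooth.congr fun x hx => ?_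
  have hcont : ContinuousOn (fun s => f (x + s * α)) (Icc (-1) 1) :=
    hf'.continuousOn.comp (by fun_prop) (hmaps x hx)
  rw [avg, integral_stepMeasure n t p ht.monotone hp _ fun i =>
    (hcont.mono (ordConnected_Icc.uIcc_subset (hbound _) (hbound _))).intervalIntegrable]
  refine Finset.sum_congr rfl fun i _ => ?_
  rw [intervalIntegral.integral_interval_sub_left (hII _ (hmaps x hx _ (hbound _)))
    (hII _ (hmaps x hx _ (hbound _)))]
  simp_rw [mul_comm _ α]
  rw [intervalIntegral.integral_comp_add_mul f hα.ne', smul_eq_mul]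
end

section
/- Fix -1 = t₀ < t₁ < ⋯ < t_n < t_{n+1} = 1 and nonnegative reals p₀, …, p_n with Σ_{i=0}^{n} (t_{i+1}-t_i) p_i = 1, and let μ be the Borel probability measure on [-1,1] with piecewise constant density equal to p_i on [t_i, t_{i+1}). Let k ≥ 1, let f : [a,b] → ℝ be continuous and piecewise k-differentiable, and let 0 < 2α < b - a. Then the α-averaging f_α is continuously differentiable and piecewise (k+1)-differentiable on [a+α, b-α]: there is a finite set S′ ⊂ (a+α, b-α) such that f_α has continuous derivatives of all orders ≤ k+1 on [a+α, b-α] ∖ S′, with finite one-sided limits of all these derivatives at each point of S′. -/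
open MeasureTheory Set Filter

/-- `f` is continuous on `[a,b]` and piecewise `k`-differentiable with (finite) break set
`S ⊂ (a,b)`: `f` has continuous derivatives of all orders `≤ k` on `[a,b] ∖ S`, and at every
point of `S` all derivatives of orders `1,…,k` have finite one-sided limits. -/
def PiecewiseDiffOn (k : ℕ) (f : ℝ → ℝ) (a b : ℝ) (S : Set ℝ) : Prop :=
  ContinuousOn f (Icc a b) ∧ S.Finite ∧ S ⊆ Ioo a b ∧
  ContDiffOn ℝ k f (Icc a b \ S) ∧
  ∀ j : ℕ, 1 ≤ j → j ≤ k → ∀ s ∈ S,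
    (∃ l : ℝ, Tendsto (iteratedDerivWithin j f (Icc a b \ S))
      (nhdsWithin s (Iio s)) (nhds l)) ∧
    (∃ r : ℝ, Tendsto (iteratedDerivWithin j f (Icc a b \ S))
      (nhdsWithin s (Ioi s)) (nhds r))

theorem iteratedDerivWithin_eq_iteratedDeriv_of_mem_nhds {f : ℝ → ℝ} {D : Set ℝ} {x : ℝ} (j : ℕ)
    (hD : D ∈ nhds x) : iteratedDerivWithin j f D x = iteratedDeriv j f x := by
  rw [← iteratedDerivWithin_univ, iteratedDerivWithin, iteratedDerivWithin,
    iteratedFDerivWithin_congr_set (eventuallyEq_univ.2 hD) j]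

/-- A function that is `C^k` on `(s, c)`, continuous from the right at `s`, and whose derivatives
up to order `k` have right limits at `s`, is `C^k` on `[s, c)`. -/
theorem contDiffOn_Ico_of_tendsto_iteratedDeriv {s c : ℝ} (hsc : s < c) (k : ℕ) :
    ∀ f : ℝ → ℝ, ContinuousWithinAt f (Ioo s c) s → ContDiffOn ℝ k f (Ioo s c) →
      (∀ j : ℕ, 1 ≤ j → j ≤ k →
        ∃ r : ℝ, Tendsto (iteratedDeriv j f) (nhdsWithin s (Ioi s)) (nhds r)) →
      ContDiffOn ℝ k f (Ico s c) := by
  have hnh : Ioo s c ∈ nhdsWithin s (Ioi s) := Ioo_mem_nhdsGT hsc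
  induction k with
  | zero =>
    intro f hcont hf _
    rw [Nat.cast_zero, contDiffOn_zero] at hf ⊢
    intro x hx
    rcases eq_or_lt_of_le hx.1 with rfl | hlt
    · rw [← Ioo_insert_left hsc]
      exact hcont.insert
    · exact ((hf x ⟨hlt, hx.2⟩).continuousAt (Ioo_mem_nhds hlt hx.2)).continuousWithinAt
  | succ k ih =>
    intro f hcont hf hlim
    have hdiff : DifferentiableOn ℝ f (Ioo s c) := hf.differentiableOn (by simp)
    obtain ⟨r, hr⟩ := hlim 1 le_rfl (by omega)
    rw [iteratedDeriv_one] at hr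
    have hs : HasDerivWithinAt f r (Ici s) s :=
      hasDerivWithinAt_Ici_of_tendsto_deriv hdiff hcont hnh hr
    have hs' : HasDerivWithinAt f r (Ico s c) s := hs.mono Ico_subset_Ici_self
    have hsmem : s ∈ Ico s c := ⟨le_rfl, hsc⟩
    have heq : ∀ x ∈ Ioo s c, derivWithin f (Ico s c) x = deriv f x := fun x hx =>
      derivWithin_of_mem_nhds (Ico_mem_nhds hx.1 hx.2)
    have heq' : ∀ x ∈ Ioo s c, derivWithin f (Ico s c) =ᶠ[nhds x] deriv f := fun x hx =>
      mem_of_superset (isOpen_Ioo.mem_nhds hx) heq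
    have hfderiv : ContDiffOn ℝ k (deriv f) (Ioo s c) := by
      have := ((contDiffOn_succ_iff_deriv_of_isOpen isOpen_Ioo (n := (k : WithTop ℕ∞))).1
        (by exact_mod_cast hf)).2.2
      exact this
    rw [Nat.cast_succ, contDiffOn_succ_iff_derivWithin (uniqueDiffOn_Ico s c)]
    refine ⟨?_, fun h => by simp at h, ih _ ?_ (hfderiv.congr heq) ?_⟩
    · intro x hx
      rcases eq_or_lt_of_le hx.1 with rfl | hlt
      · exact hs'.differentiableWithinAt
      · exact ((hdiff x ⟨hlt, hx.2⟩).differentiableAt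
          (Ioo_mem_nhds hlt hx.2)).differentiableWithinAt
    · have hval : derivWithin f (Ico s c) s = r :=
        hs'.derivWithin (uniqueDiffOn_Ico s c s hsmem)
      rw [ContinuousWithinAt, hval]
      refine Tendsto.congr' ?_ (hr.mono_left (nhdsWithin_mono s Ioo_subset_Ioi_self))
      filter_upwards [self_mem_nhdsWithin] with x hx using (heq x hx).symm
    · intro j hj hjk
      obtain ⟨l, hl⟩ := hlim (j + 1) (by omega) (by omega)
      refine ⟨l, Tendsto.congr' ?_ hl⟩
      filter_upwards [hnh] with x hx
      rw [iteratedDeriv_succ']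
      exact ((heq' x hx).iteratedDeriv_eq j).symm

theorem contDiffWithinAt_Ici_of_tendsto_iteratedDeriv {s c : ℝ} (hsc : s < c) {k : ℕ} {f : ℝ → ℝ}
    (hcont : ContinuousWithinAt f (Ioo s c) s) (hf : ContDiffOn ℝ k f (Ioo s c))
    (hlim : ∀ j : ℕ, 1 ≤ j → j ≤ k →
      ∃ r : ℝ, Tendsto (iteratedDeriv j f) (nhdsWithin s (Ioi s)) (nhds r)) :
    ContDiffWithinAt ℝ k f (Ici s) s :=
  (contDiffOn_Ico_of_tendsto_iteratedDeriv hsc k f hcont hf hlim s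
    ⟨le_rfl, hsc⟩).mono_of_mem_nhdsWithin (Ico_mem_nhdsGE hsc)

theorem contDiffWithinAt_Iic_of_tendsto_iteratedDeriv {s c : ℝ} (hcs : c < s) {k : ℕ} {f : ℝ → ℝ}
    (hcont : ContinuousWithinAt f (Ioo c s) s) (hf : ContDiffOn ℝ k f (Ioo c s))
    (hlim : ∀ j : ℕ, 1 ≤ j → j ≤ k →
      ∃ r : ℝ, Tendsto (iteratedDeriv j f) (nhdsWithin s (Iio s)) (nhds r)) :
    ContDiffWithinAt ℝ k f (Iic s) s := by
  have hmaps : MapsTo (fun x : ℝ => -x) (Ioo (-s) (-c)) (Ioo c s) := fun x hx =>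
    ⟨by linarith [hx.2], by linarith [hx.1]⟩
  have key : ContDiffWithinAt ℝ k (fun x => f (-x)) (Ici (-s)) (-s) := by
    refine contDiffWithinAt_Ici_of_tendsto_iteratedDeriv (neg_lt_neg hcs) ?_
      (hf.comp contDiff_neg.contDiffOn hmaps) fun j hj hjk => ?_
    · exact ContinuousWithinAt.comp (t := Ioo c s) (by simpa using hcont)
        continuous_neg.continuousWithinAt hmaps
    · obtain ⟨r, hr⟩ := hlim j hj hjk
      refine ⟨(-1 : ℝ) ^ j • r, ?_⟩
      have hneg : Tendsto (fun x : ℝ => -x) (nhdsWithin (-s) (Ioi (-s)))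
          (nhdsWithin s (Iio s)) := by
        simpa using tendsto_neg_nhdsGT (a := -s)
      refine ((hr.comp hneg).const_smul ((-1 : ℝ) ^ j)).congr fun x => ?_
      rw [iteratedDeriv_comp_neg]
      rfl
  have := ContDiffWithinAt.comp (s := Iic s) (f := fun x : ℝ => -x) s key
    contDiff_neg.contDiffWithinAt (fun x (hx : x ≤ s) => neg_le_neg hx)
  simpa [Function.comp_def] using this

theorem exists_tendsto_iteratedDerivWithin_of_contDiffOn {m : WithTop ℕ∞} {G : ℝ → ℝ}
    {J D : Set ℝ} {s : ℝ} {j : ℕ} {N : Filter ℝ} (hG : ContDiffOn ℝ m G J)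
    (hjm : (j : WithTop ℕ∞) ≤ m) (hJ : UniqueDiffOn ℝ J) (hs : s ∈ J) (hN : N ≤ nhdsWithin s J)
    (hmem : ∀ᶠ x in N, J ∈ nhds x ∧ D ∈ nhds x) :
    ∃ r : ℝ, Tendsto (iteratedDerivWithin j G D) N (nhds r) := by
  refine ⟨_, Tendsto.congr' ?_ ((hG.continuousOn_iteratedDerivWithin hjm hJ s hs).mono_left hN)⟩
  filter_upwards [hmem] with x hx
  rw [iteratedDerivWithin_eq_iteratedDeriv_of_mem_nhds j hx.1,
    iteratedDerivWithin_eq_iteratedDeriv_of_mem_nhds j hx.2]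

/-- Removing a finite set from `[A, B]` leaves a neighbourhood of every point close to, but
different from, a given interior point. -/
theorem eventually_diff_mem_nhds {A B s : ℝ} {S : Set ℝ} (hS : S.Finite) (hs : s ∈ Ioo A B) :
    ∀ᶠ x in nhdsWithin s {s}ᶜ, Icc A B \ S ∈ nhds x := by
  have h1 : Ioo A B \ (S \ {s}) ∈ nhds s :=
    (isOpen_Ioo.sdiff (hS.subset sdiff_subset).isClosed).mem_nhds ⟨hs, fun h => h.2 rfl⟩
  filter_upwards [mem_nhdsWithin_of_mem_nhds h1, self_mem_nhdsWithin] with x hx hxs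
  exact mem_of_superset ((isOpen_Ioo.sdiff hS.isClosed).mem_nhds ⟨hx.1, fun h => hx.2 ⟨h, hxs⟩⟩)
    (sdiff_subset_sdiff_left Ioo_subset_Icc_self)

theorem exists_tendsto_iteratedDerivWithin_nhdsGT {m j : ℕ} {G : ℝ → ℝ} {A B s : ℝ} {S : Set ℝ}
    (hG : ContDiffWithinAt ℝ m G (Ici s) s) (hjm : j ≤ m) (hS : S.Finite) (hs : s ∈ Ioo A B) :
    ∃ r : ℝ, Tendsto (iteratedDerivWithin j G (Icc A B \ S)) (nhdsWithin s (Ioi s)) (nhds r) := by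
  obtain ⟨u, hu, -, hGu⟩ := hG.contDiffOn le_rfl (by simp)
  rw [insert_eq_of_mem self_mem_Ici] at hu
  obtain ⟨c, hc, hcu⟩ := mem_nhdsGE_iff_exists_Ico_subset.1 hu
  refine exists_tendsto_iteratedDerivWithin_of_contDiffOn (hGu.mono hcu) (by exact_mod_cast hjm)
    (uniqueDiffOn_Ico s c) ⟨le_rfl, hc⟩ ?_ ?_
  · rw [nhdsWithin_Ico_eq_nhdsGE hc]
    exact nhdsWithin_mono s Ioi_subset_Ici_self
  · filter_upwards [Ioo_mem_nhdsGT hc,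
      nhdsWithin_mono s (fun x (hx : s < x) => hx.ne') (eventually_diff_mem_nhds hS hs)] with x hx hx'
    exact ⟨Ico_mem_nhds hx.1 hx.2, hx'⟩

theorem exists_tendsto_iteratedDerivWithin_nhdsLT {m j : ℕ} {G : ℝ → ℝ} {A B s : ℝ} {S : Set ℝ}
    (hG : ContDiffWithinAt ℝ m G (Iic s) s) (hjm : j ≤ m) (hS : S.Finite) (hs : s ∈ Ioo A B) :
    ∃ l : ℝ, Tendsto (iteratedDerivWithin j G (Icc A B \ S)) (nhdsWithin s (Iio s)) (nhds l) := by
  obtain ⟨u, hu, -, hGu⟩ := hG.contDiffOn le_rfl (by simp)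
  rw [insert_eq_of_mem self_mem_Iic] at hu
  obtain ⟨c, hc, hcu⟩ := mem_nhdsLE_iff_exists_Ioc_subset.1 hu
  refine exists_tendsto_iteratedDerivWithin_of_contDiffOn (hGu.mono hcu) (by exact_mod_cast hjm)
    (uniqueDiffOn_Ioc c s) ⟨hc, le_rfl⟩ ?_ ?_
  · rw [nhdsWithin_Ioc_eq_nhdsLE hc]
    exact nhdsWithin_mono s Iio_subset_Iic_self
  · filter_upwards [Ioo_mem_nhdsLT hc,
      nhdsWithin_mono s (fun x (hx : x < s) => hx.ne) (eventually_diff_mem_nhds hS hs)] with x hx hx'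
    exact ⟨Ioc_mem_nhds hx.1 hx.2, hx'⟩

theorem PiecewiseDiffOn.contDiffWithinAt_Ici {k : ℕ} {f : ℝ → ℝ} {a b : ℝ} {S : Set ℝ}
    (hf : PiecewiseDiffOn k f a b S) {y : ℝ} (hy : y ∈ Ico a b) :
    ContDiffWithinAt ℝ k f (Ici y) y := by
  obtain ⟨hcont, hfin, hsub, hdiff, hlim⟩ := hf
  by_cases hyS : y ∈ S
  · have hyab := hsub hyS
    have hev : ∀ᶠ x in nhdsWithin y (Ioi y), Icc a b \ S ∈ nhds x :=
      nhdsWithin_mono y (fun x (hx : y < x) => hx.ne') (eventually_diff_mem_nhds hfin hyab)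
    obtain ⟨c, hc, hcsub⟩ := mem_nhdsGT_iff_exists_Ioo_subset.1 hev
    have hsub' : Ioo y c ⊆ Icc a b \ S := fun x hx => mem_of_mem_nhds (hcsub hx)
    refine contDiffWithinAt_Ici_of_tendsto_iteratedDeriv hc
      ((hcont y (Ioo_subset_Icc_self hyab)).mono (hsub'.trans sdiff_subset)) (hdiff.mono hsub')
      fun j hj hjk => ?_
    obtain ⟨r, hr⟩ := (hlim j hj hjk y hyS).2
    refine ⟨r, hr.congr' ?_⟩
    filter_upwards [hev] with x hx using iteratedDerivWithin_eq_iteratedDeriv_of_mem_nhds j hx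
  · refine (hdiff y ⟨Ico_subset_Icc_self hy, hyS⟩).mono_of_mem_nhdsWithin ?_
    filter_upwards [Icc_mem_nhdsGE_of_mem hy,
      mem_nhdsWithin_of_mem_nhds (hfin.isClosed.isOpen_compl.mem_nhds hyS)] with x h1 h2
    exact ⟨h1, h2⟩

theorem PiecewiseDiffOn.contDiffWithinAt_Iic {k : ℕ} {f : ℝ → ℝ} {a b : ℝ} {S : Set ℝ}
    (hf : PiecewiseDiffOn k f a b S) {y : ℝ} (hy : y ∈ Ioc a b) :
    ContDiffWithinAt ℝ k f (Iic y) y := by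
  obtain ⟨hcont, hfin, hsub, hdiff, hlim⟩ := hf
  by_cases hyS : y ∈ S
  · have hyab := hsub hyS
    have hev : ∀ᶠ x in nhdsWithin y (Iio y), Icc a b \ S ∈ nhds x :=
      nhdsWithin_mono y (fun x (hx : x < y) => hx.ne) (eventually_diff_mem_nhds hfin hyab)
    obtain ⟨c, hc, hcsub⟩ := mem_nhdsLT_iff_exists_Ioo_subset.1 hev
    have hsub' : Ioo c y ⊆ Icc a b \ S := fun x hx => mem_of_mem_nhds (hcsub hx)
    refine contDiffWithinAt_Iic_of_tendsto_iteratedDeriv hc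
      ((hcont y (Ioo_subset_Icc_self hyab)).mono (hsub'.trans sdiff_subset)) (hdiff.mono hsub')
      fun j hj hjk => ?_
    obtain ⟨r, hr⟩ := (hlim j hj hjk y hyS).1
    refine ⟨r, hr.congr' ?_⟩
    filter_upwards [hev] with x hx using iteratedDerivWithin_eq_iteratedDeriv_of_mem_nhds j hx
  · refine (hdiff y ⟨Ioc_subset_Icc_self hy, hyS⟩).mono_of_mem_nhdsWithin ?_
    filter_upwards [Icc_mem_nhdsLE_of_mem hy,
      mem_nhdsWithin_of_mem_nhds (hfin.isClosed.isOpen_compl.mem_nhds hyS)] with x h1 h2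
    exact ⟨h1, h2⟩

theorem PiecewiseDiffOn.contDiffAt {k : ℕ} {f : ℝ → ℝ} {a b : ℝ} {S : Set ℝ}
    (hf : PiecewiseDiffOn k f a b S) {y : ℝ} (hy : y ∈ Ioo a b) (hyS : y ∉ S) :
    ContDiffAt ℝ k f y := by
  obtain ⟨-, hfin, -, hdiff, -⟩ := hf
  exact hdiff.contDiffAt (mem_of_superset ((isOpen_Ioo.sdiff hfin.isClosed).mem_nhds ⟨hy, hyS⟩)
    (sdiff_subset_sdiff_left Ioo_subset_Icc_self))

theorem contDiffWithinAt_succ_of_hasDerivAt {k : ℕ} {F g : ℝ → ℝ} {T : Set ℝ} {y : ℝ}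
    (hF : ∀ x, HasDerivAt F (g x) x) (hg : ContDiffWithinAt ℝ k g T y) :
    ContDiffWithinAt ℝ (k + 1 : ℕ) F T y := by
  rw [Nat.cast_succ, contDiffWithinAt_succ_iff_hasFDerivWithinAt (by simp)]
  refine ⟨insert y T, self_mem_nhdsWithin, fun h => by simp at h,
    fun x => ContinuousLinearMap.toSpanSingleton ℝ (g x),
    fun x _ => (hF x).hasDerivWithinAt.hasFDerivWithinAt, ?_⟩
  exact ((ContinuousLinearMap.toSpanSingletonCLE (𝕜 := ℝ) (E := ℝ)).contDiff.comp_contDiffWithinAt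
    hg.insert)

/-- The averaging by a step measure in terms of an antiderivative. -/
theorem avg_stepMeasure_eq_sum {n : ℕ} {t : Fin (n + 2) → ℝ} {p : Fin (n + 1) → ℝ}
    (ht : StrictMono t) (ht0 : t 0 = -1) (htlast : t (Fin.last (n + 1)) = 1)
    (hp : ∀ i, 0 ≤ p i) {f g F : ℝ → ℝ} {α x : ℝ} (hα : 0 < α) (hg : Continuous g)
    (hF : ∀ y, HasDerivAt F (g y) y) (hfg : EqOn f g (Icc (x - α) (x + α))) :
    avg (stepMeasure n t p) f α x =
      ∑ i : Fin (n + 1), p i * (α⁻¹ * (F (x + t i.succ * α) - F (x + t i.castSucc * α))) := by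
  have hlt : ∀ i : Fin (n + 1), t i.castSucc ≤ t i.succ := fun i =>
    ht.monotone (Fin.castSucc_lt_succ).le
  have hlow : ∀ j, -1 ≤ t j := fun j => ht0 ▸ ht.monotone (Fin.zero_le j)
  have hup : ∀ j, t j ≤ 1 := fun j => htlast ▸ ht.monotone (Fin.le_last j)
  have hgc : Continuous fun y => g (x + y * α) := by fun_prop
  have hmeas : Measurable fun y => ENNReal.ofReal (∑ i : Fin (n + 1),
      indicator (Ico (t i.castSucc) (t i.succ)) (fun _ => p i) y) :=
    ENNReal.measurable_ofReal.comp (Finset.measurable_sum _ fun i _ =>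
      measurable_const.indicator measurableSet_Ico)
  rw [avg, stepMeasure, integral_withDensity_eq_integral_toReal_smul hmeas
    (Eventually.of_forall fun _ => ENNReal.ofReal_lt_top)]
  have hpt : ∀ y, (ENNReal.ofReal (∑ i : Fin (n + 1),
      indicator (Ico (t i.castSucc) (t i.succ)) (fun _ => p i) y)).toReal • f (x + y * α) =
      ∑ i : Fin (n + 1),
        indicator (Ico (t i.castSucc) (t i.succ)) (fun y => p i * g (x + y * α)) y := by
    intro y
    rw [ENNReal.toReal_ofReal
      (Finset.sum_nonneg fun i _ => indicator_nonneg (fun _ _ => hp i) y), smul_eq_mul,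
      Finset.sum_mul]
    refine Finset.sum_congr rfl fun i _ => ?_
    by_cases hy : y ∈ Ico (t i.castSucc) (t i.succ)
    · have h1 := (hlow i.castSucc).trans hy.1
      have h2 := hy.2.le.trans (hup i.succ)
      rw [indicator_of_mem hy, indicator_of_mem hy, hfg ⟨by nlinarith, by nlinarith⟩]
    · rw [indicator_of_notMem hy, indicator_of_notMem hy, zero_mul]
  simp_rw [hpt]
  rw [integral_finsetSum _ fun i _ => ?_]
  · refine Finset.sum_congr rfl fun i _ => ?_
    rw [integral_indicator measurableSet_Ico, integral_const_mul, integral_Ico_eq_integral_Ioc,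
      ← intervalIntegral.integral_of_le (hlt i)]
    have hder : ∀ y ∈ uIcc (t i.castSucc) (t i.succ),
        HasDerivAt (fun y => α⁻¹ * F (x + y * α)) (g (x + y * α)) y := by
      intro y _
      have hinner : HasDerivAt (fun y => x + y * α) α y := by
        simpa using ((hasDerivAt_id y).mul_const α).const_add x
      have hcomp := ((hF (x + y * α)).comp y hinner).const_mul α⁻¹
      rwa [mul_comm (g _) α, inv_mul_cancel_left₀ hα.ne'] at hcomp
    rw [intervalIntegral.integral_eq_sub_of_hasDerivAt hder (hgc.intervalIntegrable _ _), mul_sub α⁻¹]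
  · rw [integrable_indicator_iff measurableSet_Ico]
    exact ((hgc.const_mul (p i)).continuousOn.integrableOn_Icc).mono_set Ico_subset_Icc_self

/-- A continuous function on an interval is the restriction of a function having a global
antiderivative. -/
theorem exists_hasDerivAt_eqOn_Icc {f : ℝ → ℝ} {a b : ℝ} (hab : a ≤ b)
    (hf : ContinuousOn f (Icc a b)) :
    ∃ g F : ℝ → ℝ, Continuous g ∧ EqOn f g (Icc a b) ∧ ∀ y, HasDerivAt F (g y) y := by
  have hg : Continuous (IccExtend hab ((Icc a b).domRestrict f)) := hf.domRestrict.Icc_extend'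
  refine ⟨_, fun y => ∫ u in a..y, IccExtend hab ((Icc a b).domRestrict f) u, hg, fun x hx => ?_,
    fun y => (hg.integral_hasStrictDerivAt a y).hasDerivAt⟩
  rw [IccExtend_of_mem hab _ hx]
  rfl

theorem averaging_piecewiseDiff_succ_stepMeasure
    (n : ℕ) (t : Fin (n + 2) → ℝ) (p : Fin (n + 1) → ℝ)
    (ht : StrictMono t) (ht0 : t 0 = -1) (htlast : t (Fin.last (n + 1)) = 1)
    (hp : ∀ i, 0 ≤ p i)
    (hsum : ∑ i : Fin (n + 1), (t i.succ - t i.castSucc) * p i = 1)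
    (a b α : ℝ) (k : ℕ) (hk : 1 ≤ k)
    (f : ℝ → ℝ) (S : Set ℝ) (hf : PiecewiseDiffOn k f a b S)
    (hα : 0 < α) (h2α : 2 * α < b - a) :
    ∃ S' : Set ℝ, S'.Finite ∧ S' ⊆ Ioo (a + α) (b - α) ∧
      ContDiffOn ℝ 1 (avg (stepMeasure n t p) f α) (Icc (a + α) (b - α)) ∧
      PiecewiseDiffOn (k + 1) (avg (stepMeasure n t p) f α) (a + α) (b - α) S' := by

  have hab : a ≤ b := by linarith
  obtain ⟨g, F, hg, hfg, hF⟩ := exists_hasDerivAt_eqOn_Icc hab hf.1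
  have hlow : ∀ j, -1 ≤ t j := fun j => ht0 ▸ ht.monotone (Fin.zero_le j)
  have hup : ∀ j, t j ≤ 1 := fun j => htlast ▸ ht.monotone (Fin.le_last j)
  set G : ℝ → ℝ := fun x =>
    ∑ i : Fin (n + 1), p i * (α⁻¹ * (F (x + t i.succ * α) - F (x + t i.castSucc * α)))
  have havg : EqOn (avg (stepMeasure n t p) f α) G (Icc (a + α) (b - α)) := fun x hx =>
    avg_stepMeasure_eq_sum ht ht0 htlast hp hα hg hF
      (hfg.mono (Icc_subset_Icc (by linarith [hx.1]) (by linarith [hx.2])))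
  have hGwithin : ∀ (m : WithTop ℕ∞) (J : Set ℝ) (x : ℝ),
      (∀ j, ContDiffWithinAt ℝ m (fun y => F (y + t j * α)) J x) → ContDiffWithinAt ℝ m G J x := by
    intro m J x h
    exact ContDiffWithinAt.sum fun i _ =>
      contDiffWithinAt_const.mul (contDiffWithinAt_const.mul ((h _).sub (h _)))
  have hshift : ∀ (m : WithTop ℕ∞) (J T : Set ℝ) (x c : ℝ), ContDiffWithinAt ℝ m F T (x + c) →
      MapsTo (fun y => y + c) J T → ContDiffWithinAt ℝ m (fun y => F (y + c)) J x := by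
    intro m J T x c h hm
    exact ContDiffWithinAt.comp (f := fun y => y + c) x h
      (contDiff_id.add contDiff_const).contDiffWithinAt hm
  have hF1 : ContDiff ℝ 1 F := by
    rw [← contDiffOn_univ]
    intro x _
    exact contDiffWithinAt_succ_of_hasDerivAt (k := 0) hF
      (by exact_mod_cast (contDiff_zero.2 hg).contDiffWithinAt)
  have hG1 : ContDiffOn ℝ 1 G (Icc (a + α) (b - α)) := fun x _ =>
    hGwithin _ _ _ fun j => hshift _ _ univ _ _ hF1.contDiffWithinAt (mapsTo_univ _ _)
  have hright : ∀ x ∈ Ico (a + α) (b - α), ContDiffWithinAt ℝ (k + 1 : ℕ) G (Ici x) x := by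
    intro x hx
    refine hGwithin _ _ _ fun j => hshift _ _ (Ici (x + t j * α)) _ _ ?_
      fun y (hy : x ≤ y) => add_le_add_left hy (t j * α)
    have hy : x + t j * α ∈ Ico a b :=
      ⟨by nlinarith [hx.1, hlow j], by nlinarith [hx.2, hup j]⟩
    refine contDiffWithinAt_succ_of_hasDerivAt hF
      ((hf.contDiffWithinAt_Ici hy).congr_of_eventuallyEq ?_ (hfg (Ico_subset_Icc_self hy)).symm)
    filter_upwards [Icc_mem_nhdsGE_of_mem hy] with z hz using (hfg hz).symm
  have hleft : ∀ x ∈ Ioc (a + α) (b - α), ContDiffWithinAt ℝ (k + 1 : ℕ) G (Iic x) x := by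
    intro x hx
    refine hGwithin _ _ _ fun j => hshift _ _ (Iic (x + t j * α)) _ _ ?_
      fun y (hy : y ≤ x) => add_le_add_left hy (t j * α)
    have hy : x + t j * α ∈ Ioc a b :=
      ⟨by nlinarith [hx.1, hlow j], by nlinarith [hx.2, hup j]⟩
    refine contDiffWithinAt_succ_of_hasDerivAt hF
      ((hf.contDiffWithinAt_Iic hy).congr_of_eventuallyEq ?_ (hfg (Ioc_subset_Icc_self hy)).symm)
    filter_upwards [Icc_mem_nhdsLE_of_mem hy] with z hz using (hfg hz).symm
  have hinner : ∀ x ∈ Ioo (a + α) (b - α), (∀ j, x + t j * α ∉ S) →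
      ContDiffAt ℝ (k + 1 : ℕ) G x := by
    intro x hx hxS
    refine hGwithin _ _ _ fun j => hshift _ _ univ _ _ ?_ (mapsTo_univ _ _)
    have hy : x + t j * α ∈ Ioo a b :=
      ⟨by nlinarith [hx.1, hlow j], by nlinarith [hx.2, hup j]⟩
    refine contDiffWithinAt_succ_of_hasDerivAt hF
      ((hf.contDiffAt hy (hxS j)).congr_of_eventuallyEq ?_).contDiffWithinAt
    filter_upwards [Icc_mem_nhds hy.1 hy.2] with z hz using (hfg hz).symm
  set S' : Set ℝ := {x | x ∈ Ioo (a + α) (b - α) ∧ ∃ j, x + t j * α ∈ S}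
  have hS'sub : S' ⊆ Ioo (a + α) (b - α) := fun x hx => hx.1
  have hS'fin : S'.Finite := by
    refine (finite_iUnion fun j =>
      hf.2.1.preimage ((add_left_injective (t j * α)).injOn)).subset ?_
    rintro x ⟨-, j, hj⟩
    exact mem_iUnion.2 ⟨j, hj⟩
  refine ⟨S', hS'fin, hS'sub, hG1.congr havg, hG1.continuousOn.congr havg, hS'fin, hS'sub, ?_, ?_⟩
  · refine ContDiffOn.congr (fun x hx => ?_) (havg.mono sdiff_subset)
    rcases eq_or_lt_of_le hx.1.1 with hxa | hxa
    · exact (hright x ⟨hx.1.1, by linarith⟩).mono fun y hy => hxa ▸ hy.1.1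
    rcases eq_or_lt_of_le hx.1.2 with hxb | hxb
    · exact (hleft x ⟨hxa, hx.1.2⟩).mono fun y hy => hxb ▸ hy.1.2
    · exact (hinner x ⟨hxa, hxb⟩ fun j hj => hx.2 ⟨⟨hxa, hxb⟩, j, hj⟩).contDiffWithinAt
  · intro j _ hjk s hs
    have hsI := hS'sub hs
    have hcongr : ∀ᶠ x in nhdsWithin s {s}ᶜ,
        iteratedDerivWithin j G (Icc (a + α) (b - α) \ S') x =
          iteratedDerivWithin j (avg (stepMeasure n t p) f α) (Icc (a + α) (b - α) \ S') x := by
      filter_upwards [eventually_diff_mem_nhds hS'fin hsI] with x hx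
      exact (iteratedDerivWithin_congr (havg.mono sdiff_subset) (mem_of_mem_nhds hx)).symm
    obtain ⟨l, hl⟩ := exists_tendsto_iteratedDerivWithin_nhdsLT
      (hleft s (Ioo_subset_Ioc_self hsI)) hjk hS'fin hsI
    obtain ⟨r, hr⟩ := exists_tendsto_iteratedDerivWithin_nhdsGT
      (hright s (Ioo_subset_Ico_self hsI)) hjk hS'fin hsI
    exact ⟨⟨l, hl.congr' (nhdsWithin_mono s (fun x (hx : x < s) => hx.ne) hcongr)⟩,
      ⟨r, hr.congr' (nhdsWithin_mono s (fun x (hx : s < x) => hx.ne') hcongr)⟩⟩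
end

section
/- Let μ be a Borel probability measure on [-1,1], let ε > 0, and let f : (-ε, ε) → ℝ be continuous, strictly decreasing on (-ε, 0] and strictly increasing on [0, ε). Suppose that for every α ∈ (0, ε/2) the α-averaging f_α is differentiable on (-ε+α, ε-α) with f′_α strictly increasing there. Then for every α ∈ (0, ε/2) the function f_α is strictly convex on (-ε+α, ε-α) and has a unique local minimum point x_α there, and the germ of f at 0 is topologically stable at 0 with respect to averagings by μ. -/
open MeasureTheory Set Filter

/-- Topological equivalence of `f` restricted to `(a,b)` and `g` restricted to `(c,d)`. -/
def TopEquivOn (f : ℝ → ℝ) (a b : ℝ) (g : ℝ → ℝ) (c d : ℝ) : Prop :=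
  ∃ h φ : ℝ → ℝ,
    ContinuousOn h (Ioo a b) ∧ StrictMonoOn h (Ioo a b) ∧
    BijOn h (Ioo a b) (Ioo c d) ∧
    OrientHomeo φ ∧
    ∀ x ∈ Ioo a b, φ (f x) = g (h x)

/-- The germ of `f` at `a` is topologically stable with respect to averagings by `μ`. -/
def TopStableAt (μ : Measure ℝ) (f : ℝ → ℝ) (a : ℝ) : Prop :=
  ∃ ε > 0, ∀ α ∈ Ioo (0 : ℝ) ε,
    ∃ c₁ c₂ d₁ d₂ : ℝ,
      c₁ ∈ Ioo (a - ε) (a + ε) ∧ c₂ ∈ Ioo (a - ε) (a + ε) ∧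
      d₁ ∈ Ioo (a - ε) (a + ε) ∧ d₂ ∈ Ioo (a - ε) (a + ε) ∧
      c₁ < a ∧ a < c₂ ∧ d₁ < d₂ ∧
      TopEquivOn f c₁ c₂ (avg μ f α) d₁ d₂

/-- A continuous function decreasing on `[a, m]` and increasing on `[m, b]` with end values
`f m + δ` attains every intermediate level on both sides of `m`. -/
theorem exists_eq_both_sides_of_level {f : ℝ → ℝ} {a m b δ : ℝ} (ham : a ≤ m) (hmb : m ≤ b)
    (hf : ContinuousOn f (Icc a b)) (hfa : f a = f m + δ) (hfb : f b = f m + δ)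
    {v : ℝ} (hv : v ∈ Ico (f m) (f m + δ)) :
    (∃ y ∈ Ioc a m, f y = v) ∧ ∃ y ∈ Ico m b, f y = v := by
  constructor
  · obtain ⟨y, hy, hyv⟩ := intermediate_value_Icc' ham (hf.mono (Icc_subset_Icc_right hmb))
      (show v ∈ Icc (f m) (f a) from ⟨hv.1, by linarith [hv.2]⟩)
    refine ⟨y, ⟨lt_of_le_of_ne hy.1 ?_, hy.2⟩, hyv⟩
    rintro rfl
    linarith [hv.2]
  · obtain ⟨y, hy, hyv⟩ := intermediate_value_Icc hmb (hf.mono (Icc_subset_Icc_left ham))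
      (show v ∈ Icc (f m) (f b) from ⟨hv.1, by linarith [hv.2]⟩)
    refine ⟨y, ⟨hy.1, lt_of_le_of_ne hy.2 ?_⟩, hyv⟩
    rintro rfl
    linarith [hv.2]

/-- Interior values of a unimodal function with equal end values lie below the end value. -/
theorem mem_Ico_of_mem_Ioo_of_unimodal {f : ℝ → ℝ} {a m b δ : ℝ} (ham : a < m) (hmb : m < b)
    (hanti : StrictAntiOn f (Icc a m)) (hmono : StrictMonoOn f (Icc m b))
    (hfa : f a = f m + δ) (hfb : f b = f m + δ) {x : ℝ} (hx : x ∈ Ioo a b) :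
    f x ∈ Ico (f m) (f m + δ) := by
  rcases le_total x m with h | h
  · exact ⟨hanti.antitoneOn ⟨hx.1.le, h⟩ ⟨ham.le, le_rfl⟩ h,
      hfa ▸ hanti ⟨le_rfl, ham.le⟩ ⟨hx.1.le, h⟩ hx.1⟩
  · exact ⟨hmono.monotoneOn ⟨le_rfl, hmb.le⟩ ⟨h, hx.2.le⟩ h,
      hfb ▸ hmono ⟨h, hx.2.le⟩ ⟨hmb.le, le_rfl⟩ hx.2⟩

/-- For each interior point there is a point on the same side of the minimum of another unimodal
function at the same height above the minimum. -/
theorem exists_same_side_same_height {f g : ℝ → ℝ} {a m b c n d δ : ℝ}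
    (ham : a < m) (hmb : m < b) (hcn : c < n) (hnd : n < d)
    (hfanti : StrictAntiOn f (Icc a m)) (hfmono : StrictMonoOn f (Icc m b))
    (hfa : f a = f m + δ) (hfb : f b = f m + δ)
    (hg : ContinuousOn g (Icc c d)) (hgc : g c = g n + δ) (hgd : g d = g n + δ)
    {x : ℝ} (hx : x ∈ Ioo a b) :
    ∃ y ∈ Ioo c d, (x < m ∧ y ≤ n ∨ m ≤ x ∧ n ≤ y) ∧ g y = f x - f m + g n := by
  have hfx := mem_Ico_of_mem_Ioo_of_unimodal ham hmb hfanti hfmono hfa hfb hx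
  obtain ⟨⟨y, hy, hyv⟩, ⟨z, hz, hzv⟩⟩ := exists_eq_both_sides_of_level hcn.le hnd.le hg hgc hgd
    (show f x - f m + g n ∈ Ico (g n) (g n + δ) from
      ⟨by linarith [hfx.1], by linarith [hfx.2]⟩)
  rcases lt_or_ge x m with h | h
  · exact ⟨y, ⟨hy.1, hy.2.trans_lt hnd⟩, .inl ⟨h, hy.2⟩, hyv⟩
  · exact ⟨z, ⟨hcn.trans_le hz.1, hz.2⟩, .inr ⟨h, hz.1⟩, hzv⟩

/-- Two unimodal functions whose end values lie at the same height above their minima are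
topologically equivalent. -/
theorem topEquivOn_of_unimodal {f g : ℝ → ℝ} {a m b c n d δ : ℝ}
    (ham : a < m) (hmb : m < b) (hcn : c < n) (hnd : n < d)
    (hf : ContinuousOn f (Icc a b))
    (hfanti : StrictAntiOn f (Icc a m)) (hfmono : StrictMonoOn f (Icc m b))
    (hfa : f a = f m + δ) (hfb : f b = f m + δ)
    (hg : ContinuousOn g (Icc c d))
    (hganti : StrictAntiOn g (Icc c n)) (hgmono : StrictMonoOn g (Icc n d))
    (hgc : g c = g n + δ) (hgd : g d = g n + δ) :
    TopEquivOn f a b g c d := by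
  choose! h hmem hside hval using fun x (hx : x ∈ Ioo a b) =>
    exists_same_side_same_height ham hmb hcn hnd hfanti hfmono hfa hfb hg hgc hgd hx
  have hstrict : StrictMonoOn h (Ioo a b) := by
    intro x hx y hy hxy
    have hcx := hmem x hx
    have hcy := hmem y hy
    have ex := hval x hx
    have ey := hval y hy
    rcases hside x hx with ⟨hxm, hxn⟩ | ⟨hxm, hxn⟩ <;>
      rcases hside y hy with ⟨hym, hyn⟩ | ⟨hym, hyn⟩
    · rw [← hganti.lt_iff_gt ⟨hcy.1.le, hyn⟩ ⟨hcx.1.le, hxn⟩]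
      linarith [hfanti ⟨hx.1.le, hxm.le⟩ ⟨hy.1.le, hym.le⟩ hxy]
    · refine lt_of_lt_of_le (lt_of_le_of_ne hxn fun e => ?_) hyn
      rw [e] at ex
      linarith [hfanti ⟨hx.1.le, hxm.le⟩ ⟨ham.le, le_rfl⟩ hxm]
    · linarith
    · rw [← hgmono.lt_iff_lt ⟨hxn, hcx.2.le⟩ ⟨hyn, hcy.2.le⟩]
      linarith [hfmono ⟨hxm, hx.2.le⟩ ⟨hym, hy.2.le⟩ hxy]
  have hsurj : SurjOn h (Ioo a b) (Ioo c d) := by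
    intro y hy
    obtain ⟨x, hx, hxy, hfx⟩ :=
      exists_same_side_same_height hcn hnd ham hmb hganti hgmono hgc hgd hf hfa hfb hy
    refine ⟨x, hx, ?_⟩
    have hcx := hmem x hx
    have ex := hval x hx
    have e : g (h x) = g y := by linarith
    rcases hside x hx with ⟨hxm, hxn⟩ | ⟨hxm, hxn⟩ <;> rcases hxy with ⟨hyn, hxm'⟩ | ⟨hyn, hxm'⟩
    · exact hganti.injOn ⟨hcx.1.le, hxn⟩ ⟨hy.1.le, hyn.le⟩ e
    · linarith
    · have hxm'' : x = m := le_antisymm hxm' hxm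
      subst hxm''
      linarith [hganti ⟨hy.1.le, hyn.le⟩ ⟨hcn.le, le_rfl⟩ hyn]
    · exact hgmono.injOn ⟨hxn, hcx.2.le⟩ ⟨hyn, hy.2.le⟩ e
  have himage : h '' Ioo a b = Ioo c d := hsurj.image_eq_of_mapsTo hmem
  refine ⟨h, fun v => v - f m + g n, fun x hx => ?_, hstrict, ⟨hmem, hstrict.injOn, hsurj⟩,
    ⟨by fun_prop, fun u v huv => by simpa using huv, fun v => ⟨v - g n + f m, by ring⟩⟩,
    fun x hx => (hval x hx).symm⟩
  refine (continuousAt_of_monotoneOn_of_image_mem_nhds hstrict.monotoneOn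
    (Ioo_mem_nhds hx.1 hx.2) ?_).continuousWithinAt
  rw [himage]
  exact Ioo_mem_nhds (hmem x hx).1 (hmem x hx).2

/-- Two unimodal functions are topologically equivalent near their minima. -/
theorem exists_topEquivOn_of_unimodal {f g : ℝ → ℝ} {a m b c n d : ℝ}
    (ham : a < m) (hmb : m < b) (hcn : c < n) (hnd : n < d)
    (hf : ContinuousOn f (Icc a b))
    (hfanti : StrictAntiOn f (Icc a m)) (hfmono : StrictMonoOn f (Icc m b))
    (hg : ContinuousOn g (Icc c d))
    (hganti : StrictAntiOn g (Icc c n)) (hgmono : StrictMonoOn g (Icc n d)) :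
    ∃ c₁ ∈ Ico a m, ∃ c₂ ∈ Ioc m b, ∃ d₁ ∈ Ico c n, ∃ d₂ ∈ Ioc n d,
      TopEquivOn f c₁ c₂ g d₁ d₂ := by
  have cut : ∀ {k : ℝ → ℝ} {p q r : ℝ}, p < q → q < r → ContinuousOn k (Icc p r) →
      ∀ δ, 0 < δ → δ ≤ k p - k q → δ ≤ k r - k q →
      ∃ s ∈ Ico p q, ∃ t ∈ Ioc q r, k s = k q + δ ∧ k t = k q + δ := by
    intro k p q r hpq hqr hk δ hδ hp hr
    obtain ⟨s, hs, hsv⟩ := intermediate_value_Icc' hpq.le (hk.mono (Icc_subset_Icc_right hqr.le))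
      (show k q + δ ∈ Icc (k q) (k p) from ⟨by linarith, by linarith⟩)
    obtain ⟨t, ht, htv⟩ := intermediate_value_Icc hqr.le (hk.mono (Icc_subset_Icc_left hpq.le))
      (show k q + δ ∈ Icc (k q) (k r) from ⟨by linarith, by linarith⟩)
    refine ⟨s, ⟨hs.1, lt_of_le_of_ne hs.2 ?_⟩, t, ⟨lt_of_le_of_ne ht.1 ?_, ht.2⟩, hsv, htv⟩
    · rintro rfl
      linarith
    · rintro rfl
      linarith
  have h1 := hfanti ⟨le_rfl, ham.le⟩ ⟨ham.le, le_rfl⟩ ham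
  have h2 := hfmono ⟨le_rfl, hmb.le⟩ ⟨hmb.le, le_rfl⟩ hmb
  have h3 := hganti ⟨le_rfl, hcn.le⟩ ⟨hcn.le, le_rfl⟩ hcn
  have h4 := hgmono ⟨le_rfl, hnd.le⟩ ⟨hnd.le, le_rfl⟩ hnd
  obtain ⟨δ, hδ, hδ1, hδ2, hδ3, hδ4⟩ : ∃ δ > 0, δ ≤ f a - f m ∧ δ ≤ f b - f m ∧
      δ ≤ g c - g n ∧ δ ≤ g d - g n :=
    ⟨min (min (f a - f m) (f b - f m)) (min (g c - g n) (g d - g n)),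
      by simp only [gt_iff_lt, lt_min_iff, sub_pos]; exact ⟨⟨h1, h2⟩, h3, h4⟩,
      by simp, by simp, by simp, by simp⟩
  obtain ⟨c₁, hc₁, c₂, hc₂, hf₁, hf₂⟩ := cut ham hmb hf δ hδ hδ1 hδ2
  obtain ⟨d₁, hd₁, d₂, hd₂, hg₁, hg₂⟩ := cut hcn hnd hg δ hδ hδ3 hδ4
  exact ⟨c₁, hc₁, c₂, hc₂, d₁, hd₁, d₂, hd₂,
    topEquivOn_of_unimodal hc₁.2 hc₂.1 hd₁.2 hd₂.1 (hf.mono (Icc_subset_Icc hc₁.1 hc₂.2))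
      (hfanti.mono (Icc_subset_Icc_left hc₁.1)) (hfmono.mono (Icc_subset_Icc_right hc₂.2))
      hf₁ hf₂ (hg.mono (Icc_subset_Icc hd₁.1 hd₂.2))
      (hganti.mono (Icc_subset_Icc_left hd₁.1)) (hgmono.mono (Icc_subset_Icc_right hd₂.2))
      hg₁ hg₂⟩

theorem add_mul_mem_Icc {x α t : ℝ} (hα : 0 ≤ α) (ht : t ∈ Icc (-1 : ℝ) 1) :
    x + t * α ∈ Icc (x - α) (x + α) :=
  ⟨by nlinarith [ht.1], by nlinarith [ht.2]⟩

theorem integrable_comp_add_mul {μ : Measure ℝ} [IsFiniteMeasure μ]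
    (hμ : ∀ᵐ t ∂μ, t ∈ Icc (-1 : ℝ) 1) {f : ℝ → ℝ} {α x : ℝ} (hα : 0 ≤ α)
    (hf : ContinuousOn f (Icc (x - α) (x + α))) :
    Integrable (fun t => f (x + t * α)) μ := by
  rw [← Measure.restrict_eq_self_of_ae_mem hμ]
  exact ContinuousOn.integrableOn_compact isCompact_Icc
    (hf.comp (by fun_prop) fun t ht => add_mul_mem_Icc hα ht)

theorem avg_le_avg_s10 {μ : Measure ℝ} [IsFiniteMeasure μ]
    (hμ : ∀ᵐ t ∂μ, t ∈ Icc (-1 : ℝ) 1) {f : ℝ → ℝ} {α x y : ℝ} (hα : 0 ≤ α)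
    (hfx : ContinuousOn f (Icc (x - α) (x + α))) (hfy : ContinuousOn f (Icc (y - α) (y + α)))
    (h : ∀ t ∈ Icc (-1 : ℝ) 1, f (x + t * α) ≤ f (y + t * α)) :
    avg μ f α x ≤ avg μ f α y :=
  integral_mono_ae (integrable_comp_add_mul hμ hα hfx) (integrable_comp_add_mul hμ hα hfy)
    (hμ.mono h)

/-- The averaging of a unimodal function has a minimum point in `[-α, α]`. -/
theorem exists_isMinOn_avg {μ : Measure ℝ} [IsFiniteMeasure μ]
    (hμ : ∀ᵐ t ∂μ, t ∈ Icc (-1 : ℝ) 1) {f : ℝ → ℝ} {ε α : ℝ} (hα : α ∈ Ioo 0 (ε / 2))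
    (hf : ContinuousOn f (Ioo (-ε) ε)) (hdec : AntitoneOn f (Ioc (-ε) 0))
    (hinc : MonotoneOn f (Ico 0 ε))
    (hcont : ContinuousOn (avg μ f α) (Ioo (-ε + α) (ε - α))) :
    ∃ x ∈ Icc (-α) α, IsMinOn (avg μ f α) (Ioo (-ε + α) (ε - α)) x := by
  obtain ⟨hα0, hαε⟩ := hα
  have hsub : ∀ x ∈ Ioo (-ε + α) (ε - α), ContinuousOn f (Icc (x - α) (x + α)) :=
    fun x hx => hf.mono fun y hy => ⟨by linarith [hx.1, hy.1], by linarith [hx.2, hy.2]⟩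
  obtain ⟨x, hx, hmin⟩ := isCompact_Icc.exists_isMinOn
    (nonempty_Icc.2 (by linarith : -α ≤ α))
    (hcont.mono fun y hy => ⟨by linarith [hy.1], by linarith [hy.2]⟩)
  refine ⟨x, hx, fun y hy => ?_⟩
  have hmin' : ∀ z ∈ Icc (-α) α, avg μ f α x ≤ avg μ f α z := fun z hz => hmin hz
  change avg μ f α x ≤ avg μ f α y
  rcases lt_or_ge y (-α) with h | h
  · refine (hmin' (-α) ⟨le_rfl, by linarith⟩).trans ?_
    refine avg_le_avg_s10 hμ hα0.le (hsub _ ⟨by linarith, by linarith⟩) (hsub y hy) fun t ht => ?_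
    have h1 := add_mul_mem_Icc (x := -α) hα0.le ht
    have h2 := add_mul_mem_Icc (x := y) hα0.le ht
    exact hdec ⟨by linarith [h2.1, hy.1], by linarith [h2.2]⟩
      ⟨by linarith [h1.1], by linarith [h1.2]⟩ (by linarith)
  rcases lt_or_ge α y with h' | h'
  · refine (hmin' α ⟨by linarith, le_rfl⟩).trans ?_
    refine avg_le_avg_s10 hμ hα0.le (hsub _ ⟨by linarith, by linarith⟩) (hsub y hy) fun t ht => ?_
    have h1 := add_mul_mem_Icc (x := α) hα0.le ht
    have h2 := add_mul_mem_Icc (x := y) hα0.le ht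
    exact hinc ⟨by linarith [h1.1], by linarith [h1.2]⟩
      ⟨by linarith [h2.1], by linarith [h2.2, hy.2]⟩ (by linarith)
  · exact hmin' y ⟨h, h'⟩

theorem stability_of_min_with_strictMono_averaged_deriv
    (μ : Measure ℝ) [IsProbabilityMeasure μ] (hsupp : μ (Icc (-1 : ℝ) 1)ᶜ = 0)
    (ε : ℝ) (hε : 0 < ε) (f : ℝ → ℝ)
    (hf : ContinuousOn f (Ioo (-ε) ε))
    (hdec : StrictAntiOn f (Ioc (-ε) 0))
    (hinc : StrictMonoOn f (Ico 0 ε))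
    (hconv : ∀ α ∈ Ioo (0 : ℝ) (ε / 2), ∃ F' : ℝ → ℝ,
      (∀ x ∈ Ioo (-ε + α) (ε - α), HasDerivAt (avg μ f α) (F' x) x) ∧
      StrictMonoOn F' (Ioo (-ε + α) (ε - α))) :
    (∀ α ∈ Ioo (0 : ℝ) (ε / 2),
      StrictConvexOn ℝ (Ioo (-ε + α) (ε - α)) (avg μ f α) ∧
      ∃! xα : ℝ, xα ∈ Ioo (-ε + α) (ε - α) ∧ IsLocalMin (avg μ f α) xα) ∧
    TopStableAt μ f 0 := by
  have hμ : ∀ᵐ t ∂μ, t ∈ Icc (-1 : ℝ) 1 := hsupp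
  have key : ∀ α ∈ Ioo (0 : ℝ) (ε / 2), ∃ x ∈ Icc (-α) α,
      IsMinOn (avg μ f α) (Ioo (-ε + α) (ε - α)) x := fun α hα => by
    obtain ⟨F', hF', -⟩ := hconv α hα
    exact exists_isMinOn_avg hμ hα hf hdec.antitoneOn hinc.monotoneOn
      fun x hx => (hF' x hx).continuousAt.continuousWithinAt
  constructor
  · intro α hα
    obtain ⟨F', hF', hmono⟩ := hconv α hα
    obtain ⟨x, hx, hmin⟩ := key α hα
    have hxI : x ∈ Ioo (-ε + α) (ε - α) :=
      ⟨by linarith [hx.1, hα.2], by linarith [hx.2, hα.2]⟩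
    have hloc : IsLocalMin (avg μ f α) x := hmin.isLocalMin (Ioo_mem_nhds hxI.1 hxI.2)
    refine ⟨StrictMonoOn.strictConvexOn_of_deriv (convex_Ioo _ _)
      (fun y hy => (hF' y hy).continuousAt.continuousWithinAt) ?_, x, ⟨hxI, hloc⟩, ?_⟩
    · rw [interior_Ioo]
      exact hmono.congr fun y hy => (hF' y hy).deriv.symm
    · rintro y ⟨hyI, hy⟩
      exact hmono.injOn hyI hxI
        ((hy.hasDerivAt_eq_zero (hF' y hyI)).trans (hloc.hasDerivAt_eq_zero (hF' x hxI)).symm)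
  · refine ⟨ε / 2, by linarith, fun α hα => ?_⟩
    obtain ⟨F', hF', hmono⟩ := hconv α hα
    obtain ⟨x, hx, hmin⟩ := key α hα
    obtain ⟨β, hαβ, hβ⟩ := exists_between hα.2
    have hsub : Icc (-β) β ⊆ Ioo (-ε + α) (ε - α) :=
      fun y hy => ⟨by linarith [hy.1], by linarith [hy.2]⟩
    have hxβ : x ∈ Ioo (-β) β := ⟨by linarith [hx.1], by linarith [hx.2]⟩
    have hxI := hsub (Ioo_subset_Icc_self hxβ)
    have hzero : F' x = 0 :=
      (hmin.isLocalMin (Ioo_mem_nhds hxI.1 hxI.2)).hasDerivAt_eq_zero (hF' x hxI)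
    have hcont : ContinuousOn (avg μ f α) (Icc (-β) β) :=
      fun y hy => (hF' y (hsub hy)).continuousAt.continuousWithinAt
    have hganti : StrictAntiOn (avg μ f α) (Icc (-β) x) := by
      refine strictAntiOn_of_deriv_neg (convex_Icc _ _)
        (hcont.mono (Icc_subset_Icc_right hxβ.2.le)) fun y hy => ?_
      rw [interior_Icc] at hy
      have hyI := hsub ⟨hy.1.le, by linarith [hy.2, hxβ.2]⟩
      rw [(hF' y hyI).deriv, ← hzero]
      exact hmono hyI hxI hy.2
    have hgmono : StrictMonoOn (avg μ f α) (Icc x β) := by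
      refine strictMonoOn_of_deriv_pos (convex_Icc _ _)
        (hcont.mono (Icc_subset_Icc_left hxβ.1.le)) fun y hy => ?_
      rw [interior_Icc] at hy
      have hyI := hsub ⟨by linarith [hy.1, hxβ.1], hy.2.le⟩
      rw [(hF' y hyI).deriv, ← hzero]
      exact hmono hxI hyI hy.1
    have hβ0 : 0 < β := hα.1.trans hαβ
    obtain ⟨c₁, hc₁, c₂, hc₂, d₁, hd₁, d₂, hd₂, heq⟩ :=
      exists_topEquivOn_of_unimodal (f := f) (neg_lt_zero.2 hβ0) hβ0 hxβ.1 hxβ.2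
        (hf.mono fun y hy => ⟨by linarith [hy.1], by linarith [hy.2]⟩)
        (hdec.mono fun y hy => ⟨by linarith [hy.1], hy.2⟩)
        (hinc.mono fun y hy => ⟨hy.1, by linarith [hy.2]⟩) hcont hganti hgmono
    exact ⟨c₁, c₂, d₁, d₂, ⟨by linarith [hc₁.1], by linarith [hc₁.2]⟩,
      ⟨by linarith [hc₂.1], by linarith [hc₂.2]⟩,
      ⟨by linarith [hd₁.1], by linarith [hd₁.2, hxβ.2]⟩,
      ⟨by linarith [hd₂.1, hxβ.1], by linarith [hd₂.2]⟩,
      hc₁.2, hc₂.1, hd₁.2.trans hd₂.1, heq⟩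
end

section
/- Fix -1 = t₀ < t₁ < ⋯ < t_n < t_{n+1} = 1 and nonnegative reals p₀, …, p_n with Σ_{i=0}^{n} (t_{i+1}-t_i) p_i = 1, and let μ be the Borel probability measure on [-1,1] with piecewise constant density equal to p_i on [t_i, t_{i+1}). Let L, R ∈ ℝ and define f : ℝ → ℝ by f(x) = L·x for x ≤ 0 and f(x) = R·x for x > 0. For 0 ≤ i ≤ n+1 set X_i = L·μ([-1, t_i]) + R·μ([t_i, 1]). Then for every α > 0 the α-averaging f_α is continuously differentiable on ℝ and its derivative is given by: f′_α(x) = L for x ≤ -α; f′_α(x) = X_{i+1} + ((x + α·t_{i+1}) / (α·(t_{i+1} - t_i)))·(X_i - X_{i+1}) for -α·t_{i+1} ≤ x ≤ -α·t_i, for each 0 ≤ i ≤ n; and f′_α(x) = R for x ≥ α. -/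
open MeasureTheory Set Filter

theorem stepMeasure_apply (n : ℕ) (t : Fin (n + 2) → ℝ) (p : Fin (n + 1) → ℝ)
    (hp : ∀ i, 0 ≤ p i) {A : Set ℝ} (hA : MeasurableSet A) :
    stepMeasure n t p A =
      ∑ i : Fin (n + 1), ENNReal.ofReal (p i) * volume (Ico (t i.castSucc) (t i.succ) ∩ A) := by
  have hdens : ∀ x, ENNReal.ofReal
      (∑ i : Fin (n + 1), indicator (Ico (t i.castSucc) (t i.succ)) (fun _ => p i) x) =
      ∑ i : Fin (n + 1),
        indicator (Ico (t i.castSucc) (t i.succ)) (fun _ => ENNReal.ofReal (p i)) x := by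
    intro x
    rw [ENNReal.ofReal_sum_of_nonneg fun i _ => indicator_nonneg (fun _ _ => hp i) x]
    refine Finset.sum_congr rfl fun i _ => ?_
    by_cases hx : x ∈ Ico (t i.castSucc) (t i.succ)
    · rw [indicator_of_mem hx, indicator_of_mem hx]
    · rw [indicator_of_notMem hx, indicator_of_notMem hx, ENNReal.ofReal_zero]
  rw [stepMeasure, withDensity_apply _ hA]
  simp_rw [hdens]
  rw [lintegral_finsetSum _ fun i _ => measurable_const.indicator measurableSet_Ico]
  refine Finset.sum_congr rfl fun i _ => ?_
  rw [lintegral_indicator_const measurableSet_Ico, Measure.restrict_apply measurableSet_Ico]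

theorem stepMeasure_nullSingletonClass (n : ℕ) (t : Fin (n + 2) → ℝ) (p : Fin (n + 1) → ℝ) :
    NullSingletonClass (stepMeasure n t p) := by
  unfold stepMeasure
  infer_instance

theorem stepMeasure_isProbabilityMeasure (n : ℕ) (t : Fin (n + 2) → ℝ) (p : Fin (n + 1) → ℝ)
    (ht : StrictMono t) (hp : ∀ i, 0 ≤ p i)
    (hsum : ∑ i : Fin (n + 1), (t i.succ - t i.castSucc) * p i = 1) :
    IsProbabilityMeasure (stepMeasure n t p) := by
  constructor
  rw [stepMeasure_apply n t p hp MeasurableSet.univ, ← ENNReal.ofReal_one, ← hsum,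
    ENNReal.ofReal_sum_of_nonneg fun i _ =>
      mul_nonneg (sub_nonneg.2 (ht (Fin.castSucc_lt_succ (i := i))).le) (hp i)]
  refine Finset.sum_congr rfl fun i _ => ?_
  rw [inter_univ, Real.volume_Ico, ← ENNReal.ofReal_mul (hp i), mul_comm]

theorem stepMeasure_compl_Ico (n : ℕ) (t : Fin (n + 2) → ℝ) (p : Fin (n + 1) → ℝ)
    (ht : StrictMono t) (hp : ∀ i, 0 ≤ p i) :
    stepMeasure n t p (Ico (t 0) (t (Fin.last (n + 1))))ᶜ = 0 := by
  rw [stepMeasure_apply n t p hp measurableSet_Ico.compl]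
  refine Finset.sum_eq_zero fun i _ => ?_
  have hsub : Ico (t i.castSucc) (t i.succ) ⊆ Ico (t 0) (t (Fin.last (n + 1))) :=
    Ico_subset_Ico (ht.monotone (Fin.zero_le _)) (ht.monotone (Fin.le_last _))
  rw [← sdiff_eq, sdiff_eq_empty.2 hsub, measure_empty, mul_zero]

theorem stepMeasure_real_Ico (n : ℕ) (t : Fin (n + 2) → ℝ) (p : Fin (n + 1) → ℝ)
    (ht : StrictMono t) (hp : ∀ i, 0 ≤ p i) (i : Fin (n + 1)) {s : ℝ}
    (hs : s ∈ Icc (t i.castSucc) (t i.succ)) :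
    (stepMeasure n t p).real (Ico (t i.castSucc) s) = p i * (s - t i.castSucc) := by
  rw [measureReal_def, stepMeasure_apply n t p hp measurableSet_Ico,
    Finset.sum_eq_single_of_mem i (Finset.mem_univ i)]
  · rw [inter_eq_right.2 (Ico_subset_Ico_right hs.2), Real.volume_Ico, ENNReal.toReal_mul,
      ENNReal.toReal_ofReal (hp i), ENNReal.toReal_ofReal (sub_nonneg.2 hs.1)]
  · intro j _ hj
    have hempty : Ico (t j.castSucc) (t j.succ) ∩ Ico (t i.castSucc) s = ∅ := by
      rw [eq_empty_iff_forall_notMem]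
      rintro x ⟨hx, hx'⟩
      rcases lt_or_gt_of_ne hj with h | h
      · have := ht.monotone (Fin.succ_le_castSucc_iff.2 h)
        linarith [hx.2, hx'.1]
      · have := ht.monotone (Fin.succ_le_castSucc_iff.2 h)
        linarith [hx.1, hx'.2, hs.2]
    rw [hempty, measure_empty, mul_zero]

theorem continuous_measureReal_Iio (μ : Measure ℝ) [IsFiniteMeasure μ] [NullSingletonClass μ] :
    Continuous fun s => μ.real (Iio s) := by
  have hreal : ∀ s, μ.real (Iio s) = ∫ y, indicator (Iio s) (fun _ => (1 : ℝ)) y ∂μ := fun s => by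
    rw [integral_indicator_const _ measurableSet_Iio, smul_eq_mul, mul_one]
  simp_rw [hreal, continuous_iff_continuousAt]
  intro s
  refine continuousAt_of_dominated (bound := fun _ => 1) ?_ ?_ (integrable_const _) ?_
  · exact .of_forall fun s =>
      (measurable_const.indicator measurableSet_Iio).aestronglyMeasurable
  · refine .of_forall fun s => .of_forall fun y => ?_
    exact (norm_indicator_le_norm_self _ _).trans (by simp)
  · filter_upwards [compl_mem_ae_iff.2 (measure_singleton s)] with y hy
    rcases lt_or_gt_of_ne (show y ≠ s from hy) with h | h
    · refine continuousAt_const.congr (f := fun _ => (1 : ℝ)) ?_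
      filter_upwards [lt_mem_nhds h] with z hz
      rw [indicator_of_mem (show y ∈ Iio z from hz)]
    · refine continuousAt_const.congr (f := fun _ => (0 : ℝ)) ?_
      filter_upwards [gt_mem_nhds h] with z hz
      rw [indicator_of_notMem (show y ∉ Iio z from not_lt.2 (le_of_lt hz))]

theorem lipschitzWith_ite_mul (L R : ℝ) :
    LipschitzWith (Real.nnabs L + Real.nnabs (R - L))
      fun x : ℝ => if x ≤ 0 then L * x else R * x := by
  have heq : (fun x : ℝ => if x ≤ 0 then L * x else R * x) =
      fun x => L * x + (R - L) * max x 0 := by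
    funext x
    split_ifs with h
    · rw [max_eq_right h]; ring
    · rw [max_eq_left (not_le.1 h).le]; ring
  rw [heq]
  refine LipschitzWith.of_dist_le_mul fun x y => ?_
  simp only [Real.dist_eq, NNReal.coe_add, Real.coe_nnabs]
  have h1 : L * x + (R - L) * max x 0 - (L * y + (R - L) * max y 0) =
      L * (x - y) + (R - L) * (max x 0 - max y 0) := by ring
  rw [h1, add_mul]
  refine (abs_add_le _ _).trans ?_
  rw [abs_mul, abs_mul]
  exact add_le_add_right
    (mul_le_mul_of_nonneg_left (abs_max_sub_max_le_abs x y 0) (abs_nonneg _)) _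

theorem hasDerivAt_ite_mul_of_neg (L R : ℝ) {x : ℝ} (hx : x < 0) :
    HasDerivAt (fun x : ℝ => if x ≤ 0 then L * x else R * x) L x := by
  refine HasDerivAt.congr_of_eventuallyEq (f := fun x => L * x)
    (by simpa using (hasDerivAt_id x).const_mul L) ?_
  filter_upwards [gt_mem_nhds hx] with z hz
  exact if_pos (le_of_lt hz)

theorem hasDerivAt_ite_mul_of_pos (L R : ℝ) {x : ℝ} (hx : 0 < x) :
    HasDerivAt (fun x : ℝ => if x ≤ 0 then L * x else R * x) R x := by
  refine HasDerivAt.congr_of_eventuallyEq (f := fun x => R * x)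
    (by simpa using (hasDerivAt_id x).const_mul R) ?_
  filter_upwards [lt_mem_nhds hx] with z hz
  exact if_neg (not_le.2 hz)

/-- The averaging of a two-piece linear function by an atomless compactly supported probability
measure is differentiable, with derivative an affine function of the distribution function. -/
theorem hasDerivAt_avg_ite_mul (μ : Measure ℝ) [IsProbabilityMeasure μ] [NullSingletonClass μ]
    {a b : ℝ}
    (hμ : ∀ᵐ y ∂μ, y ∈ Icc a b) (L R : ℝ) {α : ℝ} (hα : 0 < α) (x : ℝ) :
    HasDerivAt (avg μ (fun x => if x ≤ 0 then L * x else R * x) α)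
      (R + (L - R) * μ.real (Iio (-x / α))) x := by
  set f : ℝ → ℝ := fun x => if x ≤ 0 then L * x else R * x
  have hlip := lipschitzWith_ite_mul L R
  have hcont : Continuous f := hlip.continuous
  have hval : R + (L - R) * μ.real (Iio (-x / α)) =
      ∫ y, (R + indicator (Iio (-x / α)) (fun _ => L - R) y) ∂μ := by
    rw [integral_add (integrable_const _)
      ((integrable_const _).indicator measurableSet_Iio),
      integral_indicator_const _ measurableSet_Iio, integral_const]
    simp [mul_comm]
  rw [hval]
  unfold avg
  refine (hasDerivAt_integral_of_dominated_loc_of_lip (s := univ)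
    (bound := fun _ => (Real.nnabs L + Real.nnabs (R - L) : NNReal)) univ_mem
    ?_ ?_ ?_ ?_ (integrable_const _) ?_).2
  · exact .of_forall fun x => (hcont.comp (by fun_prop)).aestronglyMeasurable
  · have hc : Continuous fun y => f (x + y * α) := hcont.comp (by fun_prop)
    obtain ⟨C, hC⟩ := isCompact_Icc.exists_bound_of_continuousOn (hc.continuousOn (s := Icc a b))
    exact Integrable.of_bound hc.aestronglyMeasurable C (hμ.mono hC)
  · exact (measurable_const.add
      (measurable_const.indicator measurableSet_Iio)).aestronglyMeasurable
  · refine .of_forall fun y => LipschitzWith.lipschitzOnWith ?_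
    have hnn : ∀ K : NNReal, Real.nnabs (K : ℝ) = K := fun K => by ext; simp
    rw [hnn]
    refine LipschitzWith.of_dist_le_mul fun u v => ?_
    simpa using hlip.dist_le_mul (u + y * α) (v + y * α)
  · filter_upwards [compl_mem_ae_iff.2 (measure_singleton (-x / α))] with y hy
    rcases lt_or_gt_of_ne (show y ≠ -x / α from hy) with h | h
    · rw [indicator_of_mem (show y ∈ Iio (-x / α) from h), add_sub_cancel]
      rw [lt_div_iff₀ hα] at h
      exact (hasDerivAt_ite_mul_of_neg L R (by linarith)).comp_add_const x (y * α)
    · rw [indicator_of_notMem (show y ∉ Iio (-x / α) from not_lt.2 h.le), add_zero]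
      rw [div_lt_iff₀ hα] at h
      exact (hasDerivAt_ite_mul_of_pos L R (by linarith)).comp_add_const x (y * α)

theorem averaging_deriv_of_LxRx
    (n : ℕ) (t : Fin (n + 2) → ℝ) (p : Fin (n + 1) → ℝ)
    (ht : StrictMono t) (ht0 : t 0 = -1) (htlast : t (Fin.last (n + 1)) = 1)
    (hp : ∀ i, 0 ≤ p i)
    (hsum : ∑ i : Fin (n + 1), (t i.succ - t i.castSucc) * p i = 1)
    (L R : ℝ) (f : ℝ → ℝ) (hf : ∀ x, f x = if x ≤ 0 then L * x else R * x)
    (X : Fin (n + 2) → ℝ)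
    (hX : ∀ i, X i =
      L * (stepMeasure n t p (Icc (-1) (t i))).toReal +
      R * (stepMeasure n t p (Icc (t i) 1)).toReal)
    (α : ℝ) (hα : 0 < α) :
    ∃ F' : ℝ → ℝ, Continuous F' ∧
      (∀ x, HasDerivAt (avg (stepMeasure n t p) f α) (F' x) x) ∧
      (∀ x, x ≤ -α → F' x = L) ∧
      (∀ i : Fin (n + 1), ∀ x ∈ Icc (-(α * t i.succ)) (-(α * t i.castSucc)),
        F' x = X i.succ +
          ((x + α * t i.succ) / (α * (t i.succ - t i.castSucc))) *
            (X i.castSucc - X i.succ)) ∧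
      (∀ x, α ≤ x → F' x = R) := by
  have hatoms := stepMeasure_nullSingletonClass n t p
  have hprob := stepMeasure_isProbabilityMeasure n t p ht hp hsum
  have hnull := stepMeasure_compl_Ico n t p ht hp
  have hIco := stepMeasure_real_Ico n t p ht hp
  rw [ht0, htlast] at hnull
  set μ := stepMeasure n t p
  have hsupp : ∀ᵐ y ∂μ, y ∈ Ico (-1 : ℝ) 1 := hnull
  have hX' : ∀ i, X i = R + (L - R) * μ.real (Iio (t i)) := by
    intro i
    have h1 : μ (Icc (-1) (t i)) = μ (Iio (t i)) := by
      rw [measure_congr (Iio_ae_eq_Iic (μ := μ) (a := t i))]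
      refine measure_congr ?_
      filter_upwards [hsupp] with y hy
      exact propext ⟨fun h => h.2, fun h => ⟨hy.1, h⟩⟩
    have h2 : μ (Icc (t i) 1) = μ (Iio (t i))ᶜ := by
      refine measure_congr ?_
      filter_upwards [hsupp] with y hy
      exact propext ⟨fun h => not_lt.2 h.1, fun h => ⟨not_lt.1 h, hy.2.le⟩⟩
    rw [hX, h1, h2, ← measureReal_def, ← measureReal_def,
      probReal_compl_eq_one_sub measurableSet_Iio]
    ring
  have hstep : ∀ i : Fin (n + 1), ∀ s ∈ Icc (t i.castSucc) (t i.succ),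
      μ.real (Iio s) = μ.real (Iio (t i.castSucc)) + p i * (s - t i.castSucc) := by
    intro i s hs
    rw [← hIco i hs, ← Iio_union_Ico_eq_Iio hs.1]
    refine measureReal_union ?_ measurableSet_Ico
    exact disjoint_left.2 fun y hy hy' => not_lt.2 hy'.1 hy
  obtain rfl : f = fun x => if x ≤ 0 then L * x else R * x := funext hf
  refine ⟨fun x => R + (L - R) * μ.real (Iio (-x / α)), ?_, fun x => ?_, fun x hx => ?_,
    fun i x hx => ?_, fun x hx => ?_⟩
  · have := (continuous_measureReal_Iio μ).comp (continuous_neg.div_const α)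
    exact continuous_const.add (continuous_const.mul this)
  · exact hasDerivAt_avg_ite_mul μ (hsupp.mono fun y hy => Ico_subset_Icc_self hy) L R hα x
  · have h1 : 1 ≤ -x / α := by rw [le_div_iff₀ hα]; linarith
    have h2 : μ (Iio (-x / α)) = 1 :=
      (mem_ae_iff_prob_eq_one measurableSet_Iio).1
        (hsupp.mono fun y hy => hy.2.trans_le h1)
    simp [measureReal_def, h2]
  · have hs : -x / α ∈ Icc (t i.castSucc) (t i.succ) := by
      constructor
      · rw [le_div_iff₀ hα]; linarith [hx.2]
      · rw [div_le_iff₀ hα]; linarith [hx.1]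
    have hlt : t i.castSucc < t i.succ := ht Fin.castSucc_lt_succ
    have hd : t i.succ - t i.castSucc ≠ 0 := (sub_pos.2 hlt).ne'
    simp only [hX']
    rw [hstep i _ hs, hstep i _ (right_mem_Icc.2 hlt.le)]
    field_simp
    ring
  · have h1 : -x / α ≤ -1 := by rw [div_le_iff₀ hα]; linarith
    have h2 : μ (Iio (-x / α)) = 0 :=
      measure_mono_null
      (fun y hy hy' => absurd hy'.1 (not_le.2 (lt_of_lt_of_le hy h1)) : _ ⊆ (Ico (-1 : ℝ) 1)ᶜ) hnull
    simp [measureReal_def, h2]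
end

section
/- Let f : ℝ → ℝ be defined by f(x) = -x for x ≤ 0 and f(x) = 2x for x > 0, and let μ be the Borel probability measure on [-1,1] with density p given by p(t) = 1 for t ∈ [-1, -1/2], p(t) = 0 for t ∈ (-1/2, 0], and p(t) = 1/4 for t ∈ (0, 1]. Then for every α > 0 the α-averaging f_α is constant on the segment [0, α/2]; consequently the germ of f at 0 is not topologically stable at 0 with respect to averagings by μ. -/
open MeasureTheory Set Filter

/-- The density `p(t) = 1` on `[-1,-1/2]`, `p(t) = 0` on `(-1/2,0]`, `p(t) = 1/4` on `(0,1]`. -/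
noncomputable def exDensity : ℝ → ℝ := fun t =>
  if t ∈ Icc (-1 : ℝ) (-(1 / 2)) then 1
  else if t ∈ Ioc (-(1 / 2) : ℝ) 0 then 0
  else if t ∈ Ioc (0 : ℝ) 1 then 1 / 4
  else 0

/-- The measure on `ℝ` with density `exDensity`. -/
noncomputable def exMeasure : Measure ℝ :=
  volume.withDensity fun t => ENNReal.ofReal (exDensity t)

/-- The function `f(x) = -x` for `x ≤ 0` and `f(x) = 2x` for `x > 0`. -/
noncomputable def exFun : ℝ → ℝ := fun x => if x ≤ 0 then -x else 2 * x

theorem exFun_eq_max (x : ℝ) : exFun x = max (-x) (2 * x) := by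
  unfold exFun
  split_ifs with h
  · rw [max_eq_left (by linarith)]
  · rw [max_eq_right (by linarith)]

theorem continuous_exFun : Continuous exFun := by
  rw [show exFun = fun x => max (-x) (2 * x) from funext exFun_eq_max]
  fun_prop

theorem convexOn_exFun : ConvexOn ℝ univ exFun := by
  rw [show exFun = (fun x => -x) ⊔ fun x => 2 * x from funext exFun_eq_max]
  refine ConvexOn.sup ⟨convex_univ, ?_⟩ ⟨convex_univ, ?_⟩ <;>
  · intro x _ y _ a b _ _ _
    simp only [smul_eq_mul]
    linarith

theorem exDensity_eq_indicator_add_indicator (t : ℝ) :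
    exDensity t = (Icc (-1 : ℝ) (-(1 / 2))).indicator (fun _ => 1) t +
      (Ioc (0 : ℝ) 1).indicator (fun _ => 1 / 4) t := by
  simp only [exDensity, indicator_apply, mem_Icc, mem_Ioc]
  split_ifs <;> first | (exfalso; grind) | norm_num

theorem measurable_exDensity : Measurable exDensity := by
  rw [show exDensity = _ from funext exDensity_eq_indicator_add_indicator]
  exact (measurable_const.indicator measurableSet_Icc).add
    (measurable_const.indicator measurableSet_Ioc)

theorem exDensity_nonneg (t : ℝ) : 0 ≤ exDensity t := by
  unfold exDensity
  split_ifs <;> norm_num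

theorem integral_exMeasure {g : ℝ → ℝ} (hg : Continuous g) :
    ∫ t, g t ∂exMeasure =
      (∫ t in (-1 : ℝ)..(-(1 / 2)), g t) + 1 / 4 * ∫ t in (0 : ℝ)..1, g t := by
  rw [exMeasure, integral_withDensity_eq_integral_toReal_smul
    measurable_exDensity.ennreal_ofReal (by simp)]
  have h : ∀ t, (ENNReal.ofReal (exDensity t)).toReal • g t =
      (Icc (-1 : ℝ) (-(1 / 2))).indicator g t +
        (Ioc (0 : ℝ) 1).indicator (fun t => 1 / 4 * g t) t := by
    intro t
    rw [ENNReal.toReal_ofReal (exDensity_nonneg t), exDensity_eq_indicator_add_indicator]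
    simp only [indicator_apply, smul_eq_mul]
    split_ifs <;> ring
  simp_rw [h]
  rw [integral_add, integral_indicator measurableSet_Icc, integral_indicator measurableSet_Ioc,
    integral_const_mul, integral_Icc_eq_integral_Ioc,
    intervalIntegral.integral_of_le (by norm_num), intervalIntegral.integral_of_le (by norm_num)]
  · exact (integrable_indicator_iff measurableSet_Icc).2
      (hg.continuousOn.integrableOn_compact isCompact_Icc)
  · refine (integrable_indicator_iff measurableSet_Ioc).2 ?_
    exact (((hg.const_mul (1 / 4)).continuousOn.integrableOn_compact isCompact_Icc).mono_set
      Ioc_subset_Icc_self)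

theorem avg_exMeasure_exFun (α x : ℝ) :
    avg exMeasure exFun α x =
      (∫ t in (-1 : ℝ)..(-(1 / 2)), exFun (x + t * α)) +
        1 / 4 * ∫ t in (0 : ℝ)..1, exFun (x + t * α) :=
  integral_exMeasure (continuous_exFun.comp (by fun_prop : Continuous fun t => x + t * α))

theorem avg_exMeasure_exFun_of_mem {α x : ℝ} (hα : 0 < α) (hx : x ∈ Icc (0 : ℝ) (α / 2)) :
    avg exMeasure exFun α x = 5 / 8 * α := by
  obtain ⟨hx0, hx1⟩ := hx
  have h₁ : ∫ t in (-1 : ℝ)..(-(1 / 2)), exFun (x + t * α) =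
      ∫ t in (-1 : ℝ)..(-(1 / 2)), (-x + t * (-α)) := by
    refine intervalIntegral.integral_congr fun t ht => ?_
    rw [uIcc_of_le (by norm_num)] at ht
    have : t * α ≤ -(1 / 2) * α := mul_le_mul_of_nonneg_right ht.2 hα.le
    simp only [exFun]
    rw [if_pos (by linarith)]
    ring
  have h₂ : ∫ t in (0 : ℝ)..1, exFun (x + t * α) =
      ∫ t in (0 : ℝ)..1, (2 * x + t * (2 * α)) := by
    refine intervalIntegral.integral_congr fun t ht => ?_
    rw [uIcc_of_le zero_le_one] at ht
    have : 0 ≤ t * α := mul_nonneg ht.1 hα.le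
    simp only [exFun_eq_max]
    rw [max_eq_right (by linarith)]
    ring
  have h₃ (a b c d : ℝ) : ∫ t in a..b, (c + t * d) = (b - a) * c + (b ^ 2 - a ^ 2) / 2 * d := by
    rw [intervalIntegral.integral_add (by simp)
      (Continuous.intervalIntegrable (by fun_prop) _ _)]
    simp
  rw [avg_exMeasure_exFun, h₁, h₂, h₃, h₃]
  ring

theorem ConvexOn.intervalIntegral_comp_add_mul {f : ℝ → ℝ} (hf : ConvexOn ℝ univ f)
    (hc : Continuous f) {a b : ℝ} (hab : a ≤ b) (α : ℝ) :
    ConvexOn ℝ univ fun x => ∫ t in a..b, f (x + t * α) := by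
  refine ⟨convex_univ, fun x _ y _ u v hu hv huv => ?_⟩
  have hi (z : ℝ) : IntervalIntegrable (fun t => f (z + t * α)) volume a b :=
    (hc.comp (by fun_prop : Continuous fun t => z + t * α)).intervalIntegrable _ _
  simp only [smul_eq_mul]
  rw [← intervalIntegral.integral_const_mul, ← intervalIntegral.integral_const_mul,
    ← intervalIntegral.integral_add ((hi x).const_mul u) ((hi y).const_mul v)]
  refine intervalIntegral.integral_mono_on hab (hi _)
    (((hi x).const_mul u).add ((hi y).const_mul v)) fun t _ => ?_
  have h := hf.2 (mem_univ (x + t * α)) (mem_univ (y + t * α)) hu hv huv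
  simp only [smul_eq_mul] at h
  rwa [show u * (x + t * α) + v * (y + t * α) = u * x + v * y + t * α by
    linear_combination (t * α) * huv] at h

theorem convexOn_avg_exMeasure_exFun (α : ℝ) : ConvexOn ℝ univ (avg exMeasure exFun α) := by
  rw [show avg exMeasure exFun α = _ from funext (avg_exMeasure_exFun α)]
  exact (convexOn_exFun.intervalIntegral_comp_add_mul continuous_exFun (by norm_num) α).add
    (ConvexOn.smul (by norm_num : (0 : ℝ) ≤ 1 / 4)
      (convexOn_exFun.intervalIntegral_comp_add_mul continuous_exFun zero_le_one α))

/-- A convex function that is constant on a nondegenerate segment has no strict local minimum. -/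
theorem ConvexOn.exists_ne_le_of_eqOn_Icc {g : ℝ → ℝ} (hg : ConvexOn ℝ univ g) {a b k : ℝ}
    (hab : a < b) (hk : ∀ x ∈ Icc a b, g x = k) {c d p : ℝ} (hp : p ∈ Ioo c d) :
    ∃ y ∈ Ioo c d, y ≠ p ∧ g y ≤ g p := by
  have hmin : ∀ x, k ≤ g x := by
    have hm : (a + b) / 2 ∈ Ioo a b := ⟨by linarith, by linarith⟩
    have hloc : IsLocalMin g ((a + b) / 2) := by
      filter_upwards [Ioo_mem_nhds hm.1 hm.2] with x hx
      rw [hk _ (Ioo_subset_Icc_self hm), hk x (Ioo_subset_Icc_self hx)]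
    intro x
    rw [← hk _ (Ioo_subset_Icc_self hm)]
    exact IsMinOn.of_isLocalMin_of_convex_univ hloc hg x
  obtain ⟨q, hqp, hq⟩ : ∃ q, q ≠ p ∧ g q = k := by
    by_cases h : a = p
    · exact ⟨b, by rw [← h]; exact hab.ne', hk b (right_mem_Icc.2 hab.le)⟩
    · exact ⟨a, h, hk a (left_mem_Icc.2 hab.le)⟩
  have hcont : Tendsto (fun s : ℝ => (1 - s) * p + s * q) (nhdsWithin 0 (Ioi 0)) (nhds p) := by
    have : Continuous fun s : ℝ => (1 - s) * p + s * q := by fun_prop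
    simpa using (this.tendsto 0).mono_left nhdsWithin_le_nhds
  obtain ⟨s, hs, hs0, hs1⟩ := ((hcont.eventually (Ioo_mem_nhds hp.1 hp.2)).and
    (Ioo_mem_nhdsGT (zero_lt_one (α := ℝ)))).exists
  refine ⟨_, hs, fun h => ?_, ?_⟩
  · have : s * (q - p) = 0 := by linarith
    rcases mul_eq_zero.1 this with h | h
    · exact hs0.ne' h
    · exact hqp (sub_eq_zero.1 h)
  · have h := hg.2 (mem_univ p) (mem_univ q) (sub_nonneg.2 hs1.le) hs0.le (by ring)
    simp only [smul_eq_mul] at h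
    have := mul_nonneg hs0.le (sub_nonneg.2 (hmin p))
    rw [hq] at h
    linarith

theorem exFun_zero_lt {x : ℝ} (hx : x ≠ 0) : exFun 0 < exFun x := by
  rcases lt_or_gt_of_ne hx with h | h
  · simp [exFun, h.le, h]
  · simp [exFun, h.not_ge, h]

theorem counterexample_not_stable :
    (∀ α > (0 : ℝ), ∀ x ∈ Icc (0 : ℝ) (α / 2),
      avg exMeasure exFun α x = avg exMeasure exFun α 0) ∧
    ¬ TopStableAt exMeasure exFun 0 := by
  refine ⟨fun α hα x hx => ?_, ?_⟩
  · rw [avg_exMeasure_exFun_of_mem hα hx,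
      avg_exMeasure_exFun_of_mem hα (left_mem_Icc.2 (by linarith))]
  · rintro ⟨ε, hε, H⟩
    obtain ⟨c₁, c₂, d₁, d₂, -, -, -, -, hc₁, hc₂, -, h, φ, -, -, hbij, hφ, heq⟩ :=
      H (ε / 2) ⟨by linarith, by linarith⟩
    have h0 : (0 : ℝ) ∈ Ioo c₁ c₂ := ⟨hc₁, hc₂⟩
    obtain ⟨y, hy, hne, hle⟩ :=
      (convexOn_avg_exMeasure_exFun (ε / 2)).exists_ne_le_of_eqOn_Icc
        (by linarith : (0 : ℝ) < ε / 2 / 2)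
        (fun x hx => avg_exMeasure_exFun_of_mem (by linarith) hx) (hbij.mapsTo h0)
    obtain ⟨x, hx, rfl⟩ := hbij.surjOn hy
    rw [← heq x hx, ← heq 0 h0] at hle
    exact hle.not_gt (hφ.2.1 (exFun_zero_lt fun hx0 => hne (by rw [hx0])))
end
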